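/- arXiv:1806.09305 — 7 statements merged into one kernel-verified Lean document; each statement's English description precedes it below -/
import Mathlib

section
/- Let (T,X) be a minimal semiflow which admits an invariant measure. Then the equicontinuous structure relation of (T,X) equals the regionally proximal relation: S_eq(X) = Q(X). Consequently the regionally proximal relation Q(X) is a closed T-invariant equivalence relation on X and the induced semiflow on X/Q(X) is equicontinuous and invertible. -/
open Filter Topology Set Function MeasureTheory
open scoped Uniformity symmDiff

universe u v

/-- The orbit `T x` of a point `x` under the action of `T`. -/
def orbitSet (T : Type*) {X : Type*} [SMul T X] (x : X) : Set X :=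
  Set.range fun t : T => t • x

/-- A semiflow is minimal iff every orbit is dense. -/
def SFMinimal (T : Type*) (X : Type*) [SMul T X] [TopologicalSpace X] : Prop :=
  ∀ x : X, Dense (orbitSet T x)

/-- `μ` is an invariant (Borel) probability measure for the semiflow `(T,X)`:
`μ (t⁻¹ B) = μ B` for every Borel set `B` and every `t ∈ T`. -/
def SFInvariantMeasure (T : Type*) {X : Type*} [SMul T X] [MeasurableSpace X]
    (μ : Measure X) : Prop :=
  IsProbabilityMeasure μ ∧
    ∀ (t : T) (B : Set X), MeasurableSet B → μ ((fun x => t • x) ⁻¹' B) = μ B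

/-- Topological transitivity: for all nonempty open `U V`, some `t` has `U ∩ t⁻¹V ≠ ∅`. -/
def SFTopTransitive (T : Type*) (X : Type*) [SMul T X] [TopologicalSpace X] : Prop :=
  ∀ U V : Set X, IsOpen U → U.Nonempty → IsOpen V → V.Nonempty →
    ∃ t : T, (U ∩ (fun x => t • x) ⁻¹' V).Nonempty

/-- Weak mixing: the diagonal product semiflow on `X × X` is topologically transitive. -/
def SFWeakMixing (T : Type*) (X : Type*) [SMul T X] [TopologicalSpace X] : Prop :=
  SFTopTransitive T (X × X)

/-- The regionally proximal relation `Q(X)`: `(x,x')` such that there are nets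
`xₙ → x`, `xₙ' → x'` and `tₙ` in `T` with `lim tₙxₙ = lim tₙxₙ'`. -/
def SFRegionallyProximal (T : Type*) (X : Type*) [SMul T X] [UniformSpace X] :
    Set (X × X) :=
  ⋂ ε ∈ 𝓤 X, closure {p : X × X | ∃ t : T, (t • p.1, t • p.2) ∈ ε}

/-- Equicontinuity of a semiflow on a (compact) uniform space. -/
def SFEquicontinuous (T : Type*) (X : Type*) [SMul T X] [UniformSpace X] : Prop :=
  ∀ ε ∈ 𝓤 X, ∃ δ ∈ 𝓤 X, ∀ p : X × X, p ∈ δ → ∀ t : T, (t • p.1, t • p.2) ∈ ε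

/-- Distality of a semiflow. -/
def SFDistal (T : Type*) (X : Type*) [SMul T X] [UniformSpace X] : Prop :=
  ∀ x x' : X, x ≠ x' → ∃ ε ∈ 𝓤 X, ∀ t : T, (t • x, t • x') ∉ ε

/-- `x` and `y` are proximal: some net `tₙ` has `tₙx → z` and `tₙy → z`. -/
def SFProximal (T : Type*) {X : Type*} [SMul T X] [TopologicalSpace X] (x y : X) : Prop :=
  ∃ z : X, (z, z) ∈ closure (Set.range fun t : T => (t • x, t • y))

/-- `x` is a distal point: no point of its orbit closure other than `x` is proximal to `x`. -/
def SFDistalPoint (T : Type*) {X : Type*} [SMul T X] [TopologicalSpace X] (x : X) : Prop :=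
  ∀ y ∈ closure (orbitSet T x), SFProximal T x y → y = x

/-- A relation `R ⊆ X × X` is invariant under the action. -/
def SFInvariantRel (T : Type*) {X : Type*} [SMul T X] (R : Set (X × X)) : Prop :=
  ∀ (t : T), ∀ p ∈ R, (t • p.1, t • p.2) ∈ R

/-- `x` is a minimal (almost periodic) point: its orbit closure is a minimal set. -/
def SFMinimalPoint (T : Type*) {X : Type*} [SMul T X] [TopologicalSpace X] (x : X) : Prop :=
  ∀ y ∈ closure (orbitSet T x), closure (orbitSet T y) = closure (orbitSet T x)

/-- `R` is the fiber relation of some equicontinuous factor of `(T,X)`; equivalently,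
`R` is a closed invariant equivalence relation such that the induced semiflow on `X/R`
is equicontinuous. -/
def SFIsEqFactorRel (T : Type*) (X : Type u) [Monoid T] [TopologicalSpace T]
    [TopologicalSpace X] [MulAction T X] (R : Set (X × X)) : Prop :=
  ∃ (Y : Type u) (_ : UniformSpace Y) (_ : CompactSpace Y) (_ : T2Space Y)
    (_ : MulAction T Y) (_ : ContinuousSMul T Y) (π : X → Y),
      Continuous π ∧ Function.Surjective π ∧
      (∀ (t : T) (x : X), π (t • x) = t • π x) ∧
      SFEquicontinuous T Y ∧ R = {p : X × X | π p.1 = π p.2}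

/-- `S` is the equicontinuous structure relation `S_eq(X)`: the smallest closed invariant
equivalence relation whose quotient semiflow is equicontinuous. -/
def SFIsEqStructureRel (T : Type*) (X : Type u) [Monoid T] [TopologicalSpace T]
    [TopologicalSpace X] [MulAction T X] (S : Set (X × X)) : Prop :=
  SFIsEqFactorRel T X S ∧ ∀ R : Set (X × X), SFIsEqFactorRel T X R → S ⊆ R

/-- `R` is the fiber relation of some equicontinuous *and invertible* factor of `(T,X)`. -/
def SFIsEqInvFactorRel (T : Type*) (X : Type u) [Monoid T] [TopologicalSpace T]
    [TopologicalSpace X] [MulAction T X] (R : Set (X × X)) : Prop :=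
  ∃ (Y : Type u) (_ : UniformSpace Y) (_ : CompactSpace Y) (_ : T2Space Y)
    (_ : MulAction T Y) (_ : ContinuousSMul T Y) (π : X → Y),
      Continuous π ∧ Function.Surjective π ∧
      (∀ (t : T) (x : X), π (t • x) = t • π x) ∧
      SFEquicontinuous T Y ∧ (∀ t : T, Function.Bijective fun y : Y => t • y) ∧
      R = {p : X × X | π p.1 = π p.2}

/-- `(T,X)` has a nontrivial distal factor. -/
def SFHasNontrivialDistalFactor (T : Type*) (X : Type u) [Monoid T] [TopologicalSpace T]
    [TopologicalSpace X] [MulAction T X] : Prop :=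
  ∃ (Z : Type u) (_ : UniformSpace Z) (_ : CompactSpace Z) (_ : T2Space Z)
    (_ : MulAction T Z) (_ : ContinuousSMul T Z) (π : X → Z),
      Continuous π ∧ Function.Surjective π ∧
      (∀ (t : T) (x : X), π (t • x) = t • π x) ∧
      SFDistal T Z ∧ Nontrivial Z

/-- `(T,X)` has a nontrivial equicontinuous factor. -/
def SFHasNontrivialEqFactor (T : Type*) (X : Type u) [Monoid T] [TopologicalSpace T]
    [TopologicalSpace X] [MulAction T X] : Prop :=
  ∃ (Z : Type u) (_ : UniformSpace Z) (_ : CompactSpace Z) (_ : T2Space Z)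
    (_ : MulAction T Z) (_ : ContinuousSMul T Z) (π : X → Z),
      Continuous π ∧ Function.Surjective π ∧
      (∀ (t : T) (x : X), π (t • x) = t • π x) ∧
      SFEquicontinuous T Z ∧ Nontrivial Z

/-- `T` is amenable: every semiflow with phase semigroup `T` on a compact Hausdorff
space admits an invariant Borel probability measure. -/
def SFAmenable (T : Type*) [Monoid T] [TopologicalSpace T] : Prop :=
  ∀ (Y : Type u) (_ : TopologicalSpace Y) (_ : CompactSpace Y) (_ : T2Space Y)
    (_ : MulAction T Y) (_ : ContinuousSMul T Y) (_ : MeasurableSpace Y) (_ : BorelSpace Y),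
    ∃ μ : Measure Y, SFInvariantMeasure T μ

/-- `A ⊆ T` is discretely thick: every finite `F ⊆ T` has `F t ⊆ A` for some `t`. -/
def DiscretelyThick (T : Type*) [Monoid T] (A : Set T) : Prop :=
  ∀ F : Finset T, ∃ t : T, ∀ f ∈ F, f * t ∈ A

/-- `A ⊆ T` is discretely syndetic: for some finite `K ⊆ T`, `K t ∩ A ≠ ∅` for all `t`. -/
def DiscretelySyndetic (T : Type*) [Monoid T] (A : Set T) : Prop :=
  ∃ K : Finset T, ∀ t : T, ∃ k ∈ K, k * t ∈ A

/-- `x` is a locally almost periodic point. -/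
def SFLapPoint (T : Type*) {X : Type*} [Monoid T] [SMul T X] [TopologicalSpace X]
    (x : X) : Prop :=
  ∀ U ∈ 𝓝 x, ∃ V ∈ 𝓝 x, ∃ A : Set T, DiscretelySyndetic T A ∧
    ∀ a ∈ A, ∀ y ∈ V, a • y ∈ U

/-- `(T,Y)` is an E-semiflow: topologically transitive with full ergodic center,
i.e. the only closed invariant subset of full measure for every invariant measure
is `Y` itself. -/
def SFIsESemiflow (T : Type*) (Y : Type*) [SMul T Y] [TopologicalSpace Y]
    [MeasurableSpace Y] : Prop :=
  SFTopTransitive T Y ∧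
    ∀ C : Set Y, IsClosed C → (∀ (t : T), ∀ y ∈ C, t • y ∈ C) →
      (∀ μ : Measure Y, SFInvariantMeasure T μ → μ C = 1) → C = Set.univ

/-- Veech's relation `V`: `x' ∈ V[x]` iff there are a net `xₙ' → x'`, a point `y`, and a
net `tₙ` in `T` with `tₙ x → y` and `tₙ xₙ' = y`. -/
def SFVeechV (T : Type*) {X : Type*} [SMul T X] [UniformSpace X] (x : X) : Set X :=
  {x' : X | ∃ y : X, ∀ ε ∈ 𝓤 X, ∃ (x'' : X) (t : T),
    (x', x'') ∈ ε ∧ (y, t • x) ∈ ε ∧ t • x'' = y}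

/-- Veech's relation `D`: `D[x] = ⋂_ε cls (A⁻¹ A x)` where `A = N_T(x, ε[x])`. -/
def SFVeechD (T : Type*) {X : Type*} [SMul T X] [UniformSpace X] (x : X) : Set X :=
  ⋂ ε ∈ 𝓤 X, closure {z : X | ∃ t : T, (x, t • x) ∈ ε ∧
    ∃ s : T, (x, s • x) ∈ ε ∧ t • z = s • x}

/-- `x` is an almost automorphic point: `V[x] = {x}`, i.e. whenever `tₙ x → y`,
`xₙ' → x'`, `tₙ xₙ' = y`, then `x = x'`. -/
def SFAAPoint (T : Type*) {X : Type*} [SMul T X] [UniformSpace X] (x : X) : Prop :=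
  ∀ x' ∈ SFVeechV T x, x' = x

/-- A surjective semiflow is bi-continuous if each set-valued map `x ↦ t⁻¹x` is continuous. -/
def SFBiContinuous (T : Type*) (X : Type*) [SMul T X] [UniformSpace X] : Prop :=
  (∀ t : T, Function.Surjective fun x : X => t • x) ∧
  ∀ (t : T) (x₀ : X), ∀ ε ∈ 𝓤 X, ∃ δ ∈ 𝓤 X, ∀ x : X, (x₀, x) ∈ δ →
    (∀ z : X, t • z = x → ∃ w : X, t • w = x₀ ∧ (w, z) ∈ ε) ∧
    (∀ w : X, t • w = x₀ → ∃ z : X, t • z = x ∧ (w, z) ∈ ε)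

/-- The McMahon pseudo-metric `D_J(x,x') = μ (J_x △ J_{x'})`. -/
noncomputable def mcmahonDJ {X : Type*} {Y : Type*} [MeasurableSpace Y] (μ : Measure Y)
    (J : Set (X × Y)) (x x' : X) : ℝ :=
  (μ ({y : Y | (x, y) ∈ J} ∆ {y : Y | (x', y) ∈ J})).toReal

/-- An invariant probability measure on a compact Hausdorff semiflow can be replaced by a
regular one. -/
theorem SFInvariantMeasure.exists_regular {T X : Type*} [TopologicalSpace X] [CompactSpace X]
    [T2Space X] [MeasurableSpace X] [BorelSpace X] [SMul T X] [ContinuousConstSMul T X]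
    {μ : Measure X} (hμ : SFInvariantMeasure T μ) :
    ∃ ν : Measure X, ν.Regular ∧ IsProbabilityMeasure ν ∧
      ∀ t : T, MeasurePreserving (fun x : X => t • x) ν ν := by
  obtain ⟨hprob, hinv⟩ := hμ
  obtain ⟨ν, hreg, hfin, hν⟩ := μ.exists_regular_eq_of_compactSpace
  refine ⟨ν, hreg, ⟨?_⟩, fun t => ⟨(continuous_const_smul t).measurable, ?_⟩⟩
  · have h := hν 1
    simp only [BoundedContinuousFunction.coe_one, Pi.one_apply, integral_const, smul_eq_mul,
      mul_one, probReal_univ] at h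
    rw [← ENNReal.toReal_eq_one_iff]
    exact h.symm
  · have hpres : MeasurePreserving (fun x : X => t • x) μ μ := by
      refine ⟨(continuous_const_smul t).measurable, Measure.ext fun B hB => ?_⟩
      rw [Measure.map_apply (continuous_const_smul t).measurable hB, hinv t B hB]
    have : (ν.map fun x : X => t • x).InnerRegular :=
      Measure.InnerRegular.map_of_continuous (continuous_const_smul t)
    have : IsFiniteMeasure (ν.map fun x : X => t • x) := Measure.isFiniteMeasure_map _ _
    refine Measure.ext_of_integral_eq_on_compactlySupported fun f => ?_
    have hf : Continuous fun x => f (t • x) :=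
      (map_continuous f).comp (continuous_const_smul t)
    rw [integral_map (continuous_const_smul t).aemeasurable (map_continuous f).aestronglyMeasurable]
    have h₁ := hν (BoundedContinuousFunction.mkOfCompact ⟨fun x => f (t • x), hf⟩)
    have h₂ := hν (BoundedContinuousFunction.mkOfCompact ⟨f, map_continuous f⟩)
    simp only [BoundedContinuousFunction.mkOfCompact_apply, ContinuousMap.coe_mk] at h₁ h₂
    rw [← h₁, ← h₂]
    conv_rhs => rw [← hpres.map_eq]
    rw [integral_map (continuous_const_smul t).aemeasurable (map_continuous f).aestronglyMeasurable]

/-- An invariant probability measure of a minimal semiflow has full support. -/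
theorem SFMinimal.isOpenPosMeasure {T X : Type*} [TopologicalSpace X] [CompactSpace X]
    [MeasurableSpace X] [BorelSpace X] [SMul T X] [ContinuousConstSMul T X] (hmin : SFMinimal T X)
    {μ : Measure X} [IsProbabilityMeasure μ]
    (hμ : ∀ t : T, MeasurePreserving (fun x : X => t • x) μ μ) : μ.IsOpenPosMeasure := by
  refine ⟨fun U hU hne h0 => ?_⟩
  obtain ⟨F, hF⟩ := isCompact_univ.elim_finite_subcover
    (fun t : T => (fun x : X => t • x) ⁻¹' U) (fun t => hU.preimage (continuous_const_smul t))
    (fun x _ => by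
      obtain ⟨_, hyU, t, rfl⟩ := (hmin x).inter_open_nonempty U hU hne
      exact mem_iUnion.2 ⟨t, hyU⟩)
  have : μ univ = 0 := by
    refine measure_mono_null hF ((measure_biUnion_null_iff F.countable_toSet).2 fun t _ => ?_)
    rw [(hμ t).measure_preimage hU.measurableSet.nullMeasurableSet, h0]
  simp at this

/-- A family of maps which is nonexpansive for the continuous pseudometric pulled back along `Φ`
and preserves a measure of full support is isometric for that pseudometric. -/
theorem dist_eq_of_nonexpansive_of_measurePreserving {X M : Type*} [TopologicalSpace X]
    [CompactSpace X] [MeasurableSpace X] [BorelSpace X] [PseudoMetricSpace M]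
    {μ : Measure X} [IsProbabilityMeasure μ] [μ.IsOpenPosMeasure] {f : X → X}
    (hf : Continuous f) (hμ : MeasurePreserving f μ μ) {Φ : X → M} (hΦ : Continuous Φ)
    (hle : ∀ x y, dist (Φ (f x)) (Φ (f y)) ≤ dist (Φ x) (Φ y)) (x y : X) :
    dist (Φ (f x)) (Φ (f y)) = dist (Φ x) (Φ y) := by
  have hint : ∀ {g : X → ℝ}, Continuous g → Integrable g μ := fun hg =>
    hg.integrable_of_hasCompactSupport (HasCompactSupport.of_compactSpace _)
  have key : ∀ {g h : X → ℝ}, Continuous g → Continuous h → (∀ z, g z ≤ h z) →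
      ∫ z, g z ∂μ = ∫ z, h z ∂μ → g = h := fun hg hh hgh heq =>
    (hg.ae_eq_iff_eq μ hh).1
      ((integral_eq_iff_of_ae_le (hint hg) (hint hh) (Eventually.of_forall hgh)).1 heq)
  have hcomp : ∀ {g : X → ℝ}, Continuous g → ∫ z, g (f z) ∂μ = ∫ z, g z ∂μ := fun {g} hg => by
    conv_rhs => rw [← hμ.map_eq]
    rw [integral_map hf.aemeasurable]
    rw [hμ.map_eq]
    exact (hint hg).aestronglyMeasurable
  have hcd : ∀ a : X, Continuous fun z => dist (Φ a) (Φ z) := fun a => continuous_const.dist hΦ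
  let F : X → ℝ := fun a => ∫ z, dist (Φ a) (Φ z) ∂μ
  have hF : Continuous F := by
    have hlip : LipschitzWith 1 fun m : M => ∫ z, dist m (Φ z) ∂μ := by
      refine LipschitzWith.of_le_add fun m m' => ?_
      have hm : ∀ m : M, Integrable (fun z => dist m (Φ z)) μ := fun m =>
        hint (continuous_const.dist hΦ)
      calc ∫ z, dist m (Φ z) ∂μ ≤ ∫ z, (dist m' (Φ z) + dist m m') ∂μ :=
            integral_mono (hm m) ((hm m').add (integrable_const _)) fun z => by
              have := dist_triangle m m' (Φ z)
              simp only
              linarith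
        _ = ∫ z, dist m' (Φ z) ∂μ + dist m m' := by
            rw [integral_add (hm m') (integrable_const _)]; simp
    exact hlip.continuous.comp hΦ
  have hFf : ∀ a, F (f a) = ∫ z, dist (Φ (f a)) (Φ (f z)) ∂μ := fun a =>
    (hcomp (hcd (f a))).symm
  have hFeq : (fun a => F (f a)) = F := by
    refine key (hF.comp hf) hF (fun a => ?_) (hcomp hF)
    rw [hFf]
    exact integral_mono (hint ((hcd (f a)).comp hf)) (hint (hcd a)) (hle a)
  refine congrFun (key ((hcd (f x)).comp hf) (hcd x) (hle x) ?_) y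
  exact (hFf x).symm.trans (congrFun hFeq x)

/-- The orbit evaluation of a continuous function along an equicontinuous semiflow, as a
continuous map into bounded functions on the acting monoid. -/
theorem SFEquicontinuous.exists_orbit_map {T Y : Type*} [Monoid T] [TopologicalSpace T]
    [UniformSpace Y] [CompactSpace Y] [MulAction T Y] [ContinuousSMul T Y]
    (hY : SFEquicontinuous T Y) (f : C(Y, ℝ)) :
    ∃ Φ : Y → BoundedContinuousFunction T ℝ, Continuous Φ ∧ ∀ y t, Φ y t = f (t • y) := by
  let Φ : Y → BoundedContinuousFunction T ℝ := fun y =>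
    (BoundedContinuousFunction.mkOfCompact f).compContinuous
      ⟨fun t : T => t • y, continuous_id.smul continuous_const⟩
  refine ⟨Φ, ?_, fun y t => rfl⟩
  have huc : UniformContinuous f := CompactSpace.uniformContinuous_of_continuous f.continuous
  refine UniformContinuous.continuous (Metric.uniformity_basis_dist_le.tendsto_right_iff.2 ?_)
  intro ε hε
  obtain ⟨δ, hδ, h⟩ := hY _ (huc (Metric.dist_mem_uniformity hε))
  filter_upwards [hδ] with p hp
  refine (BoundedContinuousFunction.dist_le hε.le).2 fun t => ?_
  exact (show dist (f (t • p.1)) (f (t • p.2)) < ε from h p hp t).le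

theorem ContinuousMap.exists_ne_of_ne {Y : Type*} [TopologicalSpace Y] [CompactSpace Y]
    [T2Space Y] {y y' : Y} (h : y ≠ y') : ∃ f : C(Y, ℝ), f y ≠ f y' := by
  obtain ⟨f, h0, h1, -⟩ := exists_continuous_zero_one_of_isClosed (isClosed_singleton (x := y))
    (isClosed_singleton (x := y')) (by simpa using h)
  refine ⟨f, ?_⟩
  rw [h0 rfl, h1 rfl]
  simp

/-- A pseudometric space with an isometric action onto which a compact semiflow maps
equivariantly gives rise to an equicontinuous factor. -/
theorem sfIsEqFactorRel_of_isometric {T : Type*} {X Z : Type u} [Monoid T] [TopologicalSpace T]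
    [TopologicalSpace X] [CompactSpace X] [MulAction T X] [ContinuousSMul T X]
    [PseudoMetricSpace Z] [MulAction T Z] [IsIsometricSMul T Z] {g : X → Z} (hg : Continuous g)
    (hsurj : Function.Surjective g) (hequiv : ∀ (t : T) (x : X), g (t • x) = t • g x) :
    SFIsEqFactorRel T X {p | dist (g p.1) (g p.2) = 0} := by
  have hZ : ContinuousSMul T Z := by
    refine ⟨continuous_iff_continuousAt.2 fun ⟨t₀, z₀⟩ => ?_⟩
    obtain ⟨x₀, rfl⟩ := hsurj z₀
    refine tendsto_iff_dist_tendsto_zero.2 ?_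
    have hlim : Tendsto (fun q : T × Z => dist q.2 (g x₀) + dist (g (q.1 • x₀)) (g (t₀ • x₀)))
        (𝓝 (t₀, g x₀)) (𝓝 0) := by
      have hc : Continuous
          fun q : T × Z => dist q.2 (g x₀) + dist (g (q.1 • x₀)) (g (t₀ • x₀)) :=
        (continuous_snd.dist continuous_const).add
          ((hg.comp (continuous_fst.smul continuous_const)).dist continuous_const)
      simpa using hc.tendsto (t₀, g x₀)
    refine squeeze_zero (fun _ => dist_nonneg) (fun q => ?_) hlim
    refine (dist_triangle (q.1 • q.2) (q.1 • g x₀) (t₀ • g x₀)).trans ?_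
    rw [dist_smul, hequiv, hequiv]
  have hcomp : CompactSpace Z := hsurj.compactSpace hg
  refine ⟨SeparationQuotient Z, inferInstance,
    SeparationQuotient.surjective_mk.compactSpace SeparationQuotient.continuous_mk, inferInstance,
    { one_smul := SeparationQuotient.surjective_mk.forall.2 fun z => by
        rw [← SeparationQuotient.mk_smul, one_smul]
      mul_smul := fun s t => SeparationQuotient.surjective_mk.forall.2 fun z => by
        rw [← SeparationQuotient.mk_smul, ← SeparationQuotient.mk_smul,
          ← SeparationQuotient.mk_smul, mul_smul] },
    SeparationQuotient.instContinuousSMul, SeparationQuotient.mk ∘ g,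
    SeparationQuotient.continuous_mk.comp hg, SeparationQuotient.surjective_mk.comp hsurj,
    fun t x => ?_, fun ε hε => ?_, ?_⟩
  · simp only [Function.comp_apply, hequiv]
    rfl
  · obtain ⟨r, hr, hrε⟩ := Metric.mem_uniformity_dist.1 hε
    refine ⟨_, Metric.dist_mem_uniformity hr, ?_⟩
    rintro ⟨a, b⟩
    obtain ⟨a, rfl⟩ := SeparationQuotient.surjective_mk a
    obtain ⟨b, rfl⟩ := SeparationQuotient.surjective_mk b
    intro hab t
    refine hrε ?_
    change dist (t • a) (t • b) < r
    rw [dist_smul]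
    exact hab
  · ext p
    simp only [mem_ofPred_eq, Function.comp_apply, SeparationQuotient.mk_eq_mk,
      Metric.inseparable_iff]

theorem IsClosed.measurableSet_section {X : Type*} [TopologicalSpace X]
    [MeasurableSpace X] [BorelSpace X] {J : Set (X × X)} (hJ : IsClosed J) (x : X) :
    MeasurableSet {y : X | (x, y) ∈ J} :=
  (hJ.preimage (Continuous.prodMk_right x)).measurableSet

/-- Sections of a closed set vary upper semicontinuously, so that near `x₀` they are contained in
an open set whose measure barely exceeds that of the section at `x₀`. -/
theorem IsClosed.exists_isOpen_section_subset {X : Type*} [TopologicalSpace X] [CompactSpace X]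
    [MeasurableSpace X] {μ : Measure X} [IsFiniteMeasure μ] [μ.OuterRegular] {J : Set (X × X)}
    (hJ : IsClosed J) (x₀ : X) {ε : ℝ} (hε : 0 < ε) :
    ∃ U : Set X, IsOpen U ∧ {y : X | (x₀, y) ∈ J} ⊆ U ∧
      μ.real U < μ.real {y : X | (x₀, y) ∈ J} + ε ∧
      ∀ᶠ x in 𝓝 x₀, {y : X | (x, y) ∈ J} ⊆ U := by
  obtain ⟨U, hsub, hU, hlt⟩ := {y : X | (x₀, y) ∈ J}.exists_isOpen_lt_add (μ := μ)
    (measure_ne_top _ _) (ENNReal.ofReal_pos.2 hε).ne'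
  refine ⟨U, hU, hsub, ?_, ?_⟩
  · have h := ENNReal.toReal_strict_mono (by finiteness) hlt
    rwa [ENNReal.toReal_add (measure_ne_top _ _) ENNReal.ofReal_ne_top,
      ENNReal.toReal_ofReal hε.le] at h
  · have hcl : IsClosed (Prod.fst '' (J ∩ Prod.snd ⁻¹' Uᶜ)) :=
      isClosedMap_fst_of_compactSpace _ (hJ.inter (hU.isClosed_compl.preimage continuous_snd))
    have hx₀ : x₀ ∉ Prod.fst '' (J ∩ Prod.snd ⁻¹' Uᶜ) := by
      rintro ⟨⟨a, b⟩, ⟨hab, hb⟩, rfl⟩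
      exact hb (hsub hab)
    filter_upwards [hcl.isOpen_compl.mem_nhds hx₀] with x hx y hy
    by_contra hyU
    exact hx ⟨(x, y), ⟨hy, hyU⟩, rfl⟩

theorem SFInvariantRel.section_subset {T X : Type*} [SMul T X] {J : Set (X × X)}
    (hJT : SFInvariantRel T J) (t : T) (x : X) :
    {y : X | (x, y) ∈ J} ⊆ (fun y : X => t • y) ⁻¹' {y : X | (t • x, y) ∈ J} :=
  fun _ hy => hJT t _ hy

section McMahon

variable {T X : Type*} [SMul T X] [TopologicalSpace X] [CompactSpace X] [MeasurableSpace X]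
  [BorelSpace X] {μ : Measure X} [IsFiniteMeasure μ] [μ.OuterRegular] {J : Set (X × X)}

/-- All sections of a closed invariant relation of a minimal semiflow have the same measure. -/
theorem SFMinimal.measureReal_section_eq (hmin : SFMinimal T X)
    (hμ : ∀ t : T, MeasurePreserving (fun x : X => t • x) μ μ) (hJ : IsClosed J)
    (hJT : SFInvariantRel T J) (x x' : X) :
    μ.real {y : X | (x, y) ∈ J} = μ.real {y : X | (x', y) ∈ J} := by
  suffices h : ∀ x x' : X, μ.real {y : X | (x, y) ∈ J} ≤ μ.real {y : X | (x', y) ∈ J} from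
    le_antisymm (h x x') (h x' x)
  intro x x'
  refine le_of_forall_pos_le_add fun ε hε => ?_
  obtain ⟨U, -, -, hlt, hU⟩ := hJ.exists_isOpen_section_subset (μ := μ) x' hε
  obtain ⟨_, hz, t, rfl⟩ := mem_closure_iff_nhds.1 (hmin x x') _ hU
  calc μ.real {y : X | (x, y) ∈ J}
      ≤ μ.real ((fun y : X => t • y) ⁻¹' {y : X | (t • x, y) ∈ J}) :=
        measureReal_mono (hJT.section_subset t x)
    _ = μ.real {y : X | (t • x, y) ∈ J} :=
        (hμ t).measureReal_preimage (hJ.measurableSet_section _).nullMeasurableSet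
    _ ≤ μ.real U := measureReal_mono hz
    _ ≤ μ.real {y : X | (x', y) ∈ J} + ε := hlt.le

/-- The McMahon pseudometric of a closed invariant relation is invariant. -/
theorem mcmahonDJ_smul (hmin : SFMinimal T X)
    (hμ : ∀ t : T, MeasurePreserving (fun x : X => t • x) μ μ) (hJ : IsClosed J)
    (hJT : SFInvariantRel T J) (t : T) (x x' : X) :
    mcmahonDJ μ J (t • x) (t • x') = mcmahonDJ μ J x x' := by
  have hae : ∀ x : X, {y : X | (x, y) ∈ J} =ᵐ[μ]
      (fun y : X => t • y) ⁻¹' {y : X | (t • x, y) ∈ J} := fun x => by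
    refine ae_eq_of_subset_of_measure_ge (hJT.section_subset t x) ?_
      (hJ.measurableSet_section x).nullMeasurableSet (measure_ne_top _ _)
    rw [(hμ t).measure_preimage (hJ.measurableSet_section _).nullMeasurableSet]
    rw [← ENNReal.toReal_le_toReal (measure_ne_top _ _) (measure_ne_top _ _)]
    exact (hmin.measureReal_section_eq hμ hJ hJT _ _).le
  unfold mcmahonDJ
  rw [measure_congr ((hae x).symmDiff (hae x')), ← preimage_symmDiff, (hμ t).measure_preimage
    ((hJ.measurableSet_section _).symmDiff (hJ.measurableSet_section _)).nullMeasurableSet]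

/-- The McMahon pseudometric of a closed invariant relation is continuous on the diagonal. -/
theorem tendsto_mcmahonDJ (hmin : SFMinimal T X)
    (hμ : ∀ t : T, MeasurePreserving (fun x : X => t • x) μ μ) (hJ : IsClosed J)
    (hJT : SFInvariantRel T J) (x₀ : X) :
    Tendsto (fun x => mcmahonDJ μ J x x₀) (𝓝 x₀) (𝓝 0) := by
  refine Metric.tendsto_nhds.2 fun ε hε => ?_
  obtain ⟨U, hU, hsub, hlt, hev⟩ := hJ.exists_isOpen_section_subset (μ := μ) x₀ (half_pos hε)
  filter_upwards [hev] with x hx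
  have hm := hJ.measurableSet_section
  have h₁ := measureReal_sdiff_add_inter (μ := μ) (s := {y : X | (x, y) ∈ J}) (hm x₀)
  have h₂ := measureReal_sdiff_add_inter (μ := μ) (s := {y : X | (x₀, y) ∈ J}) (hm x)
  rw [inter_comm] at h₂
  have heq := hmin.measureReal_section_eq hμ hJ hJT x x₀
  have h₃ : μ.real ({y : X | (x, y) ∈ J} \ {y : X | (x₀, y) ∈ J}) < ε / 2 := by
    refine (measureReal_mono (sdiff_subset_sdiff_left hx)).trans_lt ?_
    rw [measureReal_sdiff hsub (hm x₀)]
    linarith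
  have h₄ : mcmahonDJ μ J x x₀ ≤ μ.real ({y : X | (x, y) ∈ J} \ {y : X | (x₀, y) ∈ J}) +
      μ.real ({y : X | (x₀, y) ∈ J} \ {y : X | (x, y) ∈ J}) := measureReal_union_le _ _
  have h₅ : 0 ≤ mcmahonDJ μ J x x₀ := ENNReal.toReal_nonneg
  rw [Real.dist_eq, sub_zero, abs_of_nonneg h₅]
  linarith

end McMahon

/-- The McMahon pseudometric of a closed invariant relation defines an equicontinuous factor. -/
theorem sfIsEqFactorRel_mcmahonDJ {T : Type*} {X : Type u} [Monoid T] [TopologicalSpace T]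
    [TopologicalSpace X] [CompactSpace X] [MulAction T X] [ContinuousSMul T X]
    [MeasurableSpace X] [BorelSpace X] {μ : Measure X} [IsFiniteMeasure μ] [μ.OuterRegular]
    {J : Set (X × X)} (hmin : SFMinimal T X)
    (hμ : ∀ t : T, MeasurePreserving (fun x : X => t • x) μ μ) (hJ : IsClosed J)
    (hJT : SFInvariantRel T J) :
    SFIsEqFactorRel T X {p | mcmahonDJ μ J p.1 p.2 = 0} := by
  let m : PseudoMetricSpace X :=
    { dist := mcmahonDJ μ J
      dist_self := fun x => by simp [mcmahonDJ]
      dist_comm := fun x x' => by simp [mcmahonDJ, symmDiff_comm]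
      dist_triangle := fun _ _ _ => measureReal_symmDiff_le _ }
  have hiso : @IsIsometricSMul T X m.toPseudoEMetricSpace _ :=
    @IsIsometricSMul.mk T X m.toPseudoEMetricSpace _ fun t =>
      (@isometry_iff_dist_eq X X m m _).2 fun x x' => mcmahonDJ_smul hmin hμ hJ hJT t x x'
  have hcont : @Continuous X X _ m.toUniformSpace.toTopologicalSpace id :=
    (@continuous_iff_continuousAt X X _ m.toUniformSpace.toTopologicalSpace id).2 fun x₀ =>
      (@tendsto_iff_dist_tendsto_zero X X m _ _ _).2 (tendsto_mcmahonDJ hmin hμ hJ hJT x₀)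
  exact @sfIsEqFactorRel_of_isometric T X X _ _ _ _ _ _ m _ hiso id hcont surjective_id
    fun _ _ => rfl

/-- Points identified by every equicontinuous factor are regionally proximal. -/
theorem subset_sfRegionallyProximal_of_forall_subset {T : Type*} {X : Type u} [Monoid T]
    [TopologicalSpace T] [UniformSpace X] [CompactSpace X] [MulAction T X]
    [ContinuousSMul T X] [MeasurableSpace X] [BorelSpace X] {μ : Measure X}
    [IsProbabilityMeasure μ] [μ.OuterRegular] [μ.IsOpenPosMeasure] (hmin : SFMinimal T X)
    (hμ : ∀ t : T, MeasurePreserving (fun x : X => t • x) μ μ) {S : Set (X × X)}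
    (hS : ∀ R : Set (X × X), SFIsEqFactorRel T X R → S ⊆ R) :
    S ⊆ SFRegionallyProximal T X := by
  rintro ⟨x, x'⟩ hx
  refine mem_iInter₂.2 fun ε hε => mem_closure_iff_nhds.2 fun W hW => ?_
  obtain ⟨V, hVW, hV, hxV⟩ := mem_nhds_iff.1
    ((Continuous.prodMk_right x).continuousAt.preimage_mem_nhds hW)
  let A : Set (X × X) := {q | ∃ t : T, ∃ v ∈ V, (t • x, t • v) = q}
  have hJT : SFInvariantRel T (closure A) := fun t p hp =>
    map_mem_closure (f := fun p : X × X => (t • p.1, t • p.2)) (by fun_prop) hp <| by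
      rintro _ ⟨s, v, hv, rfl⟩
      exact ⟨t * s, v, hv, by simp only [mul_smul]⟩
  have hD : mcmahonDJ μ (closure A) x x' = 0 :=
    hS _ (sfIsEqFactorRel_mcmahonDJ hmin hμ isClosed_closure hJT) hx
  have hopen : IsOpen (V \ {y : X | (x', y) ∈ closure A}) :=
    hV.sdiff (isClosed_closure.preimage (Continuous.prodMk_right x'))
  have hnull : μ (V \ {y : X | (x', y) ∈ closure A}) = 0 := by
    refine measure_mono_null (fun v hv => Or.inl ⟨subset_closure ⟨1, v, hv.1, ?_⟩, hv.2⟩)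
      ((ENNReal.toReal_eq_zero_iff _).1 hD |>.resolve_right (measure_ne_top _ _))
    simp only [one_smul]
  have hmem : (x', x') ∈ closure A := by
    by_contra hn
    have := hopen.measure_eq_zero_iff μ |>.1 hnull
    exact (this ▸ (⟨hxV, hn⟩ : x' ∈ V \ {y : X | (x', y) ∈ closure A}) : x' ∈ (∅ : Set X))
  obtain ⟨_, hq, t, v, hv, rfl⟩ :=
    mem_closure_iff_nhds.1 hmem ε (nhds_le_uniformity x' hε)
  exact ⟨(x, v), hVW hv, t, hq⟩

/-- For an equicontinuous factor of a measure preserving semiflow, two points with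
regionally proximal lifts, or with a common translate, coincide. -/
theorem SFEquicontinuous.eq_of_factor {T X Y : Type*} [Monoid T] [TopologicalSpace T]
    [UniformSpace X] [CompactSpace X] [MulAction T X] [ContinuousSMul T X]
    [MeasurableSpace X] [BorelSpace X] {μ : Measure X} [IsProbabilityMeasure μ]
    [μ.IsOpenPosMeasure] (hμ : ∀ t : T, MeasurePreserving (fun x : X => t • x) μ μ)
    [UniformSpace Y] [CompactSpace Y] [T2Space Y] [MulAction T Y] [ContinuousSMul T Y]
    (hY : SFEquicontinuous T Y) {π : X → Y} (hπ : Continuous π)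
    (hequiv : ∀ (t : T) (x : X), π (t • x) = t • π x) {x x' : X}
    (h : (x, x') ∈ SFRegionallyProximal T X ∨ ∃ t : T, t • π x = t • π x') : π x = π x' := by
  by_contra hne
  obtain ⟨f, hf⟩ := ContinuousMap.exists_ne_of_ne hne
  obtain ⟨Φ, hΦ, hΦf⟩ := hY.exists_orbit_map f
  have hle : ∀ (t : T) (y y' : Y), dist (Φ (t • y)) (Φ (t • y')) ≤ dist (Φ y) (Φ y') :=
    fun t y y' => (BoundedContinuousFunction.dist_le dist_nonneg).2 fun s => by
      have := BoundedContinuousFunction.dist_coe_le_dist (f := Φ y) (g := Φ y') (s * t)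
      simpa only [hΦf, mul_smul] using this
  have heq : ∀ (t : T) (a b : X),
      dist (Φ (π (t • a))) (Φ (π (t • b))) = dist (Φ (π a)) (Φ (π b)) := fun t =>
    dist_eq_of_nonexpansive_of_measurePreserving (continuous_const_smul t) (hμ t)
      (hΦ.comp hπ) fun a b => by
        simp only [Function.comp_apply, hequiv]
        exact hle t _ _
  refine hf ?_
  suffices hd : dist (Φ (π x)) (Φ (π x')) = 0 by
    have := congrArg (fun φ : BoundedContinuousFunction T ℝ => φ 1) (dist_eq_zero.1 hd)
    simpa only [hΦf, one_smul] using this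
  rcases h with h | ⟨t, ht⟩
  · refine le_antisymm (le_of_forall_pos_le_add fun ε hε => ?_) dist_nonneg
    have huc : UniformContinuous (Φ ∘ π) :=
      CompactSpace.uniformContinuous_of_continuous (hΦ.comp hπ)
    have hcl : IsClosed {p : X × X | dist (Φ (π p.1)) (Φ (π p.2)) ≤ ε} :=
      isClosed_le (((hΦ.comp hπ).comp continuous_fst).dist ((hΦ.comp hπ).comp continuous_snd))
        continuous_const
    rw [zero_add]
    refine closure_minimal ?_ hcl (mem_iInter₂.1 h _ (huc (Metric.dist_mem_uniformity hε)))
    rintro ⟨a, b⟩ ⟨t, ht⟩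
    exact (heq t a b).symm.le.trans (le_of_lt ht)
  · rw [← heq t, hequiv, hequiv, ht, dist_self]

/-- Every element of the acting monoid acts surjectively on a factor of a measure preserving
semiflow with full support. -/
theorem surjective_smul_of_factor {T X Y : Type*} [TopologicalSpace X] [SMul T X]
    [MeasurableSpace X] [BorelSpace X] {μ : Measure X} [μ.IsOpenPosMeasure]
    (hμ : ∀ t : T, MeasurePreserving (fun x : X => t • x) μ μ)
    [TopologicalSpace Y] [CompactSpace Y] [T2Space Y] [SMul T Y] [ContinuousConstSMul T Y]
    {π : X → Y} (hπ : Continuous π) (hsurj : Function.Surjective π)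
    (hequiv : ∀ (t : T) (x : X), π (t • x) = t • π x) (t : T) :
    Function.Surjective fun y : Y => t • y := by
  have hopen : IsOpen (π ⁻¹' (Set.range fun y : Y => t • y)ᶜ) :=
    (isCompact_range (continuous_const_smul t)).isClosed.isOpen_compl.preimage hπ
  have hnull : μ (π ⁻¹' (Set.range fun y : Y => t • y)ᶜ) = 0 := by
    rw [← (hμ t).measure_preimage hopen.measurableSet.nullMeasurableSet]
    convert! measure_empty (μ := μ)
    refine eq_empty_of_forall_notMem fun x hx => hx ⟨π x, (hequiv t x).symm⟩
  rw [← range_eq_univ, ← compl_empty_iff]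
  rw [hopen.measure_eq_zero_iff μ] at hnull
  exact hsurj.preimage_injective (hnull.trans preimage_empty.symm)

/-- For a minimal semiflow `(T,X)` admitting an invariant measure, the
equicontinuous structure relation equals the regionally proximal relation; consequently
`Q(X)` is a closed invariant equivalence relation and the induced semiflow on `X/Q(X)`
is equicontinuous and invertible. -/
theorem stmt0 (T : Type*) (X : Type u) [Monoid T] [TopologicalSpace T]
    [UniformSpace X] [CompactSpace X] [T2Space X]
    [MulAction T X] [ContinuousSMul T X]
    [MeasurableSpace X] [BorelSpace X]
    (hmin : SFMinimal T X)
    (hmeas : ∃ μ : Measure X, SFInvariantMeasure T μ)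
    (S : Set (X × X)) (hS : SFIsEqStructureRel T X S) :
    S = SFRegionallyProximal T X ∧
    IsClosed (SFRegionallyProximal T X) ∧
    SFInvariantRel T (SFRegionallyProximal T X) ∧
    Equivalence (fun a b : X => (a, b) ∈ SFRegionallyProximal T X) ∧
    SFIsEqInvFactorRel T X (SFRegionallyProximal T X) := by
  obtain ⟨μ₀, hμ₀⟩ := hmeas
  obtain ⟨μ, hreg, hprob, hμ⟩ := hμ₀.exists_regular
  have hpos : μ.IsOpenPosMeasure := hmin.isOpenPosMeasure hμ
  have hSQ : S ⊆ SFRegionallyProximal T X :=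
    subset_sfRegionallyProximal_of_forall_subset hmin hμ hS.2
  obtain ⟨⟨Y, _, _, _, _, _, π, hπ, hsurj, hequiv, hY, hSπ⟩, -⟩ := hS
  have hQS : SFRegionallyProximal T X = S := by
    refine Subset.antisymm (fun p hp => ?_) hSQ
    rw [hSπ]
    exact hY.eq_of_factor hμ hπ hequiv (Or.inl hp)
  rw [hQS]
  refine ⟨rfl, ?_, ?_, ?_, Y, ‹_›, ‹_›, ‹_›, ‹_›, ‹_›, π, hπ, hsurj, hequiv, hY,
    fun t => ⟨?_, surjective_smul_of_factor hμ hπ hsurj hequiv t⟩, hSπ⟩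
  · rw [hSπ]
    exact isClosed_eq (hπ.comp continuous_fst) (hπ.comp continuous_snd)
  · rw [hSπ]
    intro t p hp
    simp only [mem_ofPred_eq, hequiv] at hp ⊢
    rw [hp]
  · rw [hSπ]
    exact ⟨fun _ => rfl, fun h => Eq.symm h, fun h h' => Eq.trans h h'⟩
  · refine hsurj.forall₂.2 fun x x' h => ?_
    exact hY.eq_of_factor hμ hπ hequiv (Or.inr ⟨t, h⟩)
end

section
/- Let (T,X) be a minimal distal semiflow. Then the equicontinuous structure relation of (T,X) equals the regionally proximal relation: S_eq(X) = Q(X). -/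
open Filter Topology Set Function MeasureTheory
open scoped Uniformity symmDiff

universe u v

section Ellis

variable {M X : Type*} [Monoid M] [MulAction M X]

/-- The Ellis semigroup of `(M,X)`: the pointwise closure of the set of translations. -/
def ellisSet (M X : Type*) [SMul M X] [TopologicalSpace X] : Set (X → X) :=
  closure (range fun (t : M) (x : X) => t • x)

lemma ellisSet_comp_mem [TopologicalSpace X] [ContinuousConstSMul M X] {p q : X → X}
    (hp : p ∈ ellisSet M X) (hq : q ∈ ellisSet M X) : p ∘ q ∈ ellisSet M X := by
  have hsmul : ∀ t : M, (fun x => t • x) ∘ q ∈ ellisSet M X := fun t => by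
    have hc : Continuous fun r : X → X => (fun x => t • x) ∘ r :=
      continuous_pi fun x => (continuous_apply x).const_smul t
    refine map_mem_closure hc hq ?_
    rintro _ ⟨s, rfl⟩
    exact ⟨t * s, funext fun x => mul_smul t s x⟩
  have hc : Continuous fun r : X → X => r ∘ q :=
    continuous_pi fun x => continuous_apply (q x)
  have := map_mem_closure (t := ellisSet M X) hc hp (by rintro _ ⟨t, rfl⟩; exact hsmul t)
  rwa [ellisSet, closure_closure] at this

/-- A continuous image of the Ellis semigroup is the closure of the image of the translations. -/
lemma image_ellisSet [TopologicalSpace X] [CompactSpace X] [T2Space X]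
    {Z : Type*} [TopologicalSpace Z] [T2Space Z] {ev : (X → X) → Z} (hev : Continuous ev) :
    ev '' ellisSet M X = closure (range fun t : M => ev fun x => t • x) := by
  rw [ellisSet, image_closure_of_isCompact isClosed_closure.isCompact hev.continuousOn,
    ← range_comp]
  rfl

variable [UniformSpace X]

/-- In a distal semiflow, the only idempotent of the Ellis semigroup is the identity. -/
lemma SFDistal.eq_id_of_idempotent (hd : SFDistal M X) {u : X → X} (hu : u ∈ ellisSet M X)
    (hi : u ∘ u = u) : u = id := by
  funext x
  by_contra hne
  obtain ⟨ε, hε, h⟩ := hd x (u x) (Ne.symm hne)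
  have hc : Continuous fun r : X → X => (r x, r (u x)) :=
    (continuous_apply x).prodMk (continuous_apply (u x))
  have hmem : (u x, u (u x)) ∈ closure (interior ε)ᶜ := by
    refine map_mem_closure (f := fun r : X → X => (r x, r (u x))) hc hu ?_
    rintro _ ⟨t, rfl⟩
    exact fun ht => h t (interior_subset ht)
  rw [isOpen_interior.isClosed_compl.closure_eq, show u (u x) = u x from congrFun hi x] at hmem
  exact hmem (mem_uniformity_of_eq (interior_mem_uniformity hε) rfl)

variable [CompactSpace X] [T2Space X] [ContinuousConstSMul M X]

/-- The Ellis semigroup of a distal semiflow is a group: left inverses exist. -/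
lemma SFDistal.exists_left_inverse (hd : SFDistal M X) {p : X → X} (hp : p ∈ ellisSet M X) :
    ∃ r ∈ ellisSet M X, r ∘ p = id := by
  let _ : Semigroup (X → X) := { mul := fun f g => f ∘ g, mul_assoc := fun _ _ _ => rfl }
  have hc : ∀ r : X → X, Continuous fun f : X → X => f ∘ r := fun r =>
    continuous_pi fun x => continuous_apply (r x)
  obtain ⟨m, ⟨r, hr, rfl⟩, hi⟩ := exists_idempotent_in_compact_subsemigroup hc
    ((fun f => f ∘ p) '' ellisSet M X) ⟨_, p, hp, rfl⟩
    (isClosed_closure.isCompact.image (hc p)) (by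
      rintro _ ⟨a, ha, rfl⟩ _ ⟨b, hb, rfl⟩
      exact ⟨a ∘ p ∘ b, ellisSet_comp_mem ha (ellisSet_comp_mem hp hb), rfl⟩)
  exact ⟨r, hr, hd.eq_id_of_idempotent (ellisSet_comp_mem hr hp) hi⟩

lemma SFDistal.exists_inverse (hd : SFDistal M X) {p : X → X} (hp : p ∈ ellisSet M X) :
    ∃ r ∈ ellisSet M X, r ∘ p = id ∧ p ∘ r = id := by
  obtain ⟨r, hr, hrp⟩ := hd.exists_left_inverse hp
  obtain ⟨s, hs, hsr⟩ := hd.exists_left_inverse hr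
  have hsp : s = p := by
    calc s = s ∘ (r ∘ p) := by rw [hrp]; rfl
      _ = (s ∘ r) ∘ p := rfl
      _ = p := by rw [hsr]; rfl
  exact ⟨r, hr, hrp, hsp ▸ hsr⟩

/-- In a distal semiflow every point of `X × X` has a minimal orbit closure. -/
lemma SFDistal.mem_closure_orbitSet_symm (hd : SFDistal M X) {p q : X × X}
    (h : q ∈ closure (orbitSet M p)) : p ∈ closure (orbitSet M q) := by
  have hc : ∀ a : X × X, Continuous fun r : X → X => (r a.1, r a.2) := fun a =>
    (continuous_apply a.1).prodMk (continuous_apply a.2)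
  have himg : ∀ a : X × X, (fun r : X → X => (r a.1, r a.2)) '' ellisSet M X
      = closure (orbitSet M a) := fun a => image_ellisSet (hc a)
  rw [← himg] at h ⊢
  obtain ⟨e, he, rfl⟩ := h
  obtain ⟨r, hr, hre⟩ := hd.exists_left_inverse he
  exact ⟨r, hr, Prod.ext (congrFun hre p.1) (congrFun hre p.2)⟩

/-- In a distal semiflow, if the orbit of `p` meets an open set, then the times at which it does
are syndetic. -/
lemma SFDistal.exists_finset_return (hd : SFDistal M X) {p : X × X} {O : Set (X × X)}
    (hO : IsOpen O) {t₀ : M} (h : t₀ • p ∈ O) :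
    ∃ F : Finset M, ∀ t : M, ∃ f ∈ F, (f * t) • p ∈ O := by
  obtain ⟨F, hF⟩ := (isClosed_closure (s := orbitSet M p)).isCompact.elim_finite_subcover
    (fun f : M => (fun q => f • q) ⁻¹' O) (fun f => hO.preimage (continuous_const_smul f)) (by
      intro q hq
      obtain ⟨_, hs, s, rfl⟩ := mem_closure_iff.1 (hd.mem_closure_orbitSet_symm hq)
        _ (hO.preimage (continuous_const_smul t₀)) h
      exact mem_iUnion.2 ⟨t₀ * s, by simpa [mul_smul] using hs⟩)
  refine ⟨F, fun t => ?_⟩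
  obtain ⟨f, hf, hft⟩ := mem_iUnion₂.1 (hF (subset_closure ⟨t, rfl⟩))
  exact ⟨f, hf, by simpa [mul_smul] using hft⟩

/-- In a minimal distal semiflow, the projection of an orbit closure in `X × X` to the first
coordinate is open. -/
lemma SFDistal.mem_nhds_fst_orbit_closure (hmin : SFMinimal M X) (hd : SFDistal M X) (y z : X)
    {C : Set X} (hC : C ∈ 𝓝 z) :
    {a : X | ∃ b ∈ C, (a, b) ∈ closure (orbitSet M (y, z))} ∈ 𝓝 y := by
  have himg : (fun r : X → X => r y) '' ellisSet M X = closure (orbitSet M y) :=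
    image_ellisSet (continuous_apply y)
  have hex : ∀ a : X, ∃ r ∈ ellisSet M X, r y = a := fun a => by
    have ha : a ∈ closure (orbitSet M y) := hmin y a
    rwa [← himg] at ha
  choose P hP hPy using hex
  rw [mem_iff_ultrafilter]
  intro U hU
  obtain ⟨p, hp, hlim⟩ := (isClosed_closure (s := range fun (t : M) (x : X) => t • x)).isCompact
    |>.ultrafilter_le_nhds (U.map P) (by
      rw [le_principal_iff]
      exact Eventually.of_forall (f := (U : Filter X)) hP)
  have hev : ∀ x, Tendsto (fun a => P a x) U (𝓝 (p x)) := fun x =>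
    ((continuous_apply x).tendsto p).comp hlim
  have hpy : p y = y := tendsto_nhds_unique (hev y) (by simp only [hPy]; exact tendsto_id'.2 hU)
  obtain ⟨r, hr, hrp, hpr⟩ := hd.exists_inverse hp
  have hry : r y = y := by
    have := congrFun hrp y
    rwa [comp_apply, hpy] at this
  have hlz := hev (r z)
  rw [show p (r z) = z from congrFun hpr z] at hlz
  filter_upwards [hlz hC] with a ha
  refine ⟨P a (r z), ha, ?_⟩
  have hc : Continuous fun q : X → X => (q y, q z) :=
    (continuous_apply y).prodMk (continuous_apply z)
  have himg₂ : (fun q : X → X => (q y, q z)) '' ellisSet M X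
      = closure (orbitSet M (y, z)) := image_ellisSet hc
  rw [← himg₂]
  exact ⟨P a ∘ r, ellisSet_comp_mem (hP a) hr, by simp [hry, hPy]⟩

open scoped Pointwise in
open Classical in
/-- On a nonempty open subset of any open set on which `y ↦ (x, y)` enters an open set `O`, the
return times can be controlled by one finite set. -/
lemma SFDistal.exists_uniform_return (hd : SFDistal M X) {x : X} {B : Set X} (hB : IsOpen B)
    (hBn : B.Nonempty) {O K : Set (X × X)} (hO : IsOpen O) (hK : IsClosed K) (hOK : O ⊆ K)
    {t₀ : M} (ht₀ : ∀ y ∈ B, t₀ • (x, y) ∈ O) :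
    ∃ B' ⊆ B, IsOpen B' ∧ B'.Nonempty ∧
      ∃ F : Finset M, ∀ y ∈ B', ∀ t : M, ∃ f ∈ F, (f * t) • (x, y) ∈ K := by
  by_contra! H
  let St := {p : Set X × Finset M // p.1 ⊆ B ∧ IsOpen p.1 ∧ p.1.Nonempty}
  have step : ∀ p : St, ∃ (B' : Set X) (g : M), IsOpen B' ∧ B'.Nonempty ∧
      closure B' ⊆ p.1.1 ∧ ∀ y ∈ closure B', ∀ f ∈ p.1.2, (f * g) • (x, y) ∉ K := by
    rintro ⟨⟨A, F⟩, hAB, hA, hAn⟩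
    obtain ⟨y, hy, t, hyt⟩ := H A hAB hA hAn F
    have hN : A ∩ ⋂ f ∈ F, {a | (f * t) • (x, a) ∈ K}ᶜ ∈ 𝓝 y := by
      refine inter_mem (hA.mem_nhds hy) ((biInter_finset_mem F).2 fun f hf => ?_)
      refine (IsClosed.isOpen_compl (self := ?_)).mem_nhds (hyt f hf)
      exact hK.preimage ((continuous_const_smul (f * t)).comp (Continuous.prodMk_right x))
    obtain ⟨V, hV, hVc, hVN⟩ := exists_mem_nhds_isClosed_subset hN
    have hcl : closure (interior V) ⊆ V := closure_minimal interior_subset hVc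
    refine ⟨interior V, t, isOpen_interior, ⟨y, mem_interior_iff_mem_nhds.2 hV⟩,
      fun a ha => (hVN (hcl ha)).1, fun a ha f hf => ?_⟩
    exact mem_iInter₂.1 (hVN (hcl ha)).2 f hf
  choose B' g hBo hBne hBcl hg using step
  let next : St → St := fun p => ⟨(B' p, insert (g p) (p.1.2 ∪ p.1.2 * p.1.2)),
    (subset_closure.trans (hBcl p)).trans p.2.1, hBo p, hBne p⟩
  let s : ℕ → St := fun n => next^[n] ⟨(B, {1, t₀}), Subset.rfl, hB, hBn⟩
  have hs : ∀ n, s (n + 1) = next (s n) := fun n => iterate_succ_apply' _ _ _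
  have hFmono : Monotone fun n => (s n).1.2 := monotone_nat_of_le_succ fun n => by
    rw [hs]
    exact Finset.subset_union_left.trans (Finset.subset_insert _ _)
  have hgmem : ∀ n, g (s n) ∈ (s (n + 1)).1.2 := fun n => by
    rw [hs]
    exact Finset.mem_insert_self _ _
  let N : Submonoid M :=
    { carrier := {m | ∃ n, m ∈ (s n).1.2}
      one_mem' := ⟨0, Finset.mem_insert_self _ _⟩
      mul_mem' := by
        rintro a b ⟨m, hm⟩ ⟨n, hn⟩
        refine ⟨max m n + 1, ?_⟩
        rw [hs]
        exact Finset.mem_insert_of_mem (Finset.mem_union_right _ (Finset.mul_mem_mul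
          (hFmono (le_max_left m n) hm) (hFmono (le_max_right m n) hn))) }
  obtain ⟨y, hy⟩ := IsCompact.nonempty_iInter_of_sequence_nonempty_isCompact_isClosed
    (fun n => closure (B' (s n)))
    (fun n => by
      refine closure_mono ?_
      have := hBcl (s (n + 1))
      rw [hs] at this ⊢
      exact subset_closure.trans this)
    (fun n => (hBne (s n)).closure) isClosed_closure.isCompact (fun _ => isClosed_closure)
  rw [mem_iInter] at hy
  have : ContinuousConstSMul N X := ⟨fun t => continuous_const_smul (t : M)⟩
  have hdN : SFDistal N X := fun a b hab => by
    obtain ⟨ε, hε, h⟩ := hd a b hab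
    exact ⟨ε, hε, fun t => h t⟩
  have hyB : y ∈ B := hBcl (s 0) (hy 0)
  have ht₀N : t₀ ∈ N := ⟨0, by simp [s]⟩
  obtain ⟨F, hF⟩ := hdN.exists_finset_return (t₀ := ⟨t₀, ht₀N⟩) (p := (x, y)) hO (ht₀ y hyB)
  have hFn : ∃ n, ∀ f ∈ F, (f : M) ∈ (s n).1.2 := by
    choose k hk using fun f : N => f.2
    exact ⟨F.sup k, fun f hf => hFmono (Finset.le_sup hf) (hk f)⟩
  obtain ⟨n, hn⟩ := hFn
  obtain ⟨f, hf, hfO⟩ := hF ⟨g (s n), n + 1, hgmem n⟩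
  exact hg (s n) y (hy n) f (hn f hf) (hOK hfO)

end Ellis

section RegionallyProximal

variable {M X : Type*} [Monoid M] [MulAction M X] [UniformSpace X]

lemma mem_SFRegionallyProximal {p : X × X} : p ∈ SFRegionallyProximal M X ↔
    ∀ ε ∈ 𝓤 X, p ∈ closure {q : X × X | ∃ t : M, t • q ∈ ε} :=
  mem_iInter₂

lemma isClosed_SFRegionallyProximal : IsClosed (SFRegionallyProximal M X) :=
  isClosed_biInter fun _ _ => isClosed_closure

lemma refl_mem_SFRegionallyProximal (x : X) : (x, x) ∈ SFRegionallyProximal M X :=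
  mem_SFRegionallyProximal.2 fun _ hε => subset_closure ⟨1, mem_uniformity_of_eq hε rfl⟩

lemma symm_mem_SFRegionallyProximal {x y : X} (h : (x, y) ∈ SFRegionallyProximal M X) :
    (y, x) ∈ SFRegionallyProximal M X :=
  mem_SFRegionallyProximal.2 fun _ hε => map_mem_closure (f := Prod.swap) continuous_swap
    (mem_SFRegionallyProximal.1 h _ (symm_le_uniformity hε)) fun _ ⟨t, ht⟩ => ⟨t, ht⟩

variable [CompactSpace X] [T2Space X] [ContinuousConstSMul M X]

/-- If a translate of `p` lies in an open set, so does a translate of each translate of `p`. -/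
lemma SFDistal.exists_smul_smul_mem (hd : SFDistal M X) {O : Set (X × X)} (hO : IsOpen O)
    {p : X × X} {t : M} (h : t • p ∈ O) (s : M) : ∃ r : M, r • s • p ∈ O := by
  obtain ⟨F, hF⟩ := hd.exists_finset_return hO h
  obtain ⟨f, -, hf⟩ := hF s
  exact ⟨f, by rwa [mul_smul] at hf⟩

lemma SFDistal.smul_mem_SFRegionallyProximal (hd : SFDistal M X) {p : X × X}
    (h : p ∈ SFRegionallyProximal M X) (s : M) : s • p ∈ SFRegionallyProximal M X := by
  refine mem_SFRegionallyProximal.2 fun ε hε => ?_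
  refine map_mem_closure (continuous_const_smul s)
    (mem_SFRegionallyProximal.1 h _ (interior_mem_uniformity hε)) fun q ⟨t, ht⟩ => ?_
  obtain ⟨r, hr⟩ := hd.exists_smul_smul_mem isOpen_interior ht s
  exact ⟨r, interior_subset hr⟩

lemma SFDistal.closure_orbitSet_subset (hd : SFDistal M X) {p : X × X}
    (h : p ∈ SFRegionallyProximal M X) : closure (orbitSet M p) ⊆ SFRegionallyProximal M X :=
  closure_minimal (by rintro _ ⟨s, rfl⟩; exact hd.smul_mem_SFRegionallyProximal h s)
    isClosed_SFRegionallyProximal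

lemma SFDistal.trans_mem_SFRegionallyProximal (hmin : SFMinimal M X) (hd : SFDistal M X)
    {x y z : X} (hxy : (x, y) ∈ SFRegionallyProximal M X)
    (hyz : (y, z) ∈ SFRegionallyProximal M X) : (x, z) ∈ SFRegionallyProximal M X := by
  refine mem_SFRegionallyProximal.2 fun ε hε => mem_closure_iff_nhds.2 fun W hW => ?_
  obtain ⟨A, hA, C, hC, hAC⟩ := mem_nhds_prod_iff.1 hW
  obtain ⟨η, hη, hηε⟩ := comp_mem_uniformity_sets hε
  obtain ⟨κ, ⟨hκ, hκc⟩, hκη⟩ := uniformity_hasBasis_closed.mem_iff.1 hη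
  let B := {a : X | ∃ b ∈ interior C, (a, b) ∈ closure (orbitSet M (y, z))}
  have hBn : B ∈ 𝓝 y := hd.mem_nhds_fst_orbit_closure hmin y z (interior_mem_nhds.2 hC)
  obtain ⟨⟨x₁, y₀⟩, ⟨hx₁, hy₀⟩, t₀, ht₀⟩ := mem_closure_iff_nhds.1
    (mem_SFRegionallyProximal.1 hxy _ (interior_mem_uniformity hκ)) _
    (prod_mem_nhds hA (interior_mem_nhds.2 hBn))
  have hopen : IsOpen (interior B ∩ {a | t₀ • (x₁, a) ∈ interior κ}) :=
    isOpen_interior.inter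
      (isOpen_interior.preimage ((continuous_const_smul t₀).comp (Continuous.prodMk_right x₁)))
  obtain ⟨B', hB'B, hB'o, ⟨y₁, hy₁⟩, F, hF⟩ := hd.exists_uniform_return hopen ⟨y₀, hy₀, ht₀⟩
    isOpen_interior hκc interior_subset fun a ha => ha.2
  obtain ⟨z₁, hz₁, hyz₁⟩ := interior_subset (hB'B hy₁).1
  have hδ : (⋂ f ∈ F, (fun p : X × X => f • p) ⁻¹' κ) ∈ 𝓤 X :=
    (biInter_finset_mem F).2 fun f _ =>
      CompactSpace.uniformContinuous_of_continuous (continuous_const_smul f) hκ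
  obtain ⟨⟨y₂, z₂⟩, ⟨hy₂, hz₂⟩, t, ht⟩ := mem_closure_iff_nhds.1
    (mem_SFRegionallyProximal.1 (hd.closure_orbitSet_subset hyz hyz₁) _ hδ) _
    (prod_mem_nhds (hB'o.mem_nhds hy₁) (isOpen_interior.mem_nhds hz₁))
  obtain ⟨f, hf, hfκ⟩ := hF y₂ hy₂ t
  refine ⟨(x₁, z₂), hAC ⟨hx₁, interior_subset hz₂⟩, f * t, hηε ⟨(f * t) • y₂, hκη hfκ, hκη ?_⟩⟩
  have := mem_iInter₂.1 ht f hf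
  simpa [mul_smul] using this

/-- Regional proximality as an equivalence relation, for a minimal distal semiflow. -/
def SFDistal.rpSetoid (hmin : SFMinimal M X) (hd : SFDistal M X) : Setoid X where
  r x y := (x, y) ∈ SFRegionallyProximal M X
  iseqv := ⟨refl_mem_SFRegionallyProximal, symm_mem_SFRegionallyProximal,
    hd.trans_mem_SFRegionallyProximal hmin⟩

lemma SFDistal.isOpenQuotientMap_mk (hmin : SFMinimal M X) (hd : SFDistal M X) :
    IsOpenQuotientMap (Quotient.mk (hd.rpSetoid hmin)) := by
  refine ⟨Quotient.mk_surjective, continuous_quotient_mk', fun U hU => ?_⟩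
  refine isOpen_coinduced.2 (isOpen_iff_mem_nhds.2 ?_)
  rintro y ⟨z, hz, hzy⟩
  have hyz : (y, z) ∈ SFRegionallyProximal M X :=
    symm_mem_SFRegionallyProximal (Quotient.exact hzy)
  filter_upwards [hd.mem_nhds_fst_orbit_closure hmin y z (hU.mem_nhds hz)]
  rintro a ⟨b, hb, hab⟩
  exact ⟨b, hb, Quotient.sound
    (symm_mem_SFRegionallyProximal (hd.closure_orbitSet_subset hyz hab))⟩

/-- Translates of a sufficiently small entourage stay in a given open neighbourhood of the
regionally proximal relation. -/
lemma SFDistal.exists_entourage_smul_mem (hd : SFDistal M X) {N : Set (X × X)} (hN : IsOpen N)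
    (hQN : SFRegionallyProximal M X ⊆ N) :
    ∃ δ ∈ 𝓤 X, IsOpen δ ∧ ∀ p ∈ δ, ∀ t : M, t • p ∈ N := by
  have hne : Nonempty {ε // ε ∈ 𝓤 X} := ⟨⟨univ, univ_mem⟩⟩
  obtain ⟨⟨ε, hε⟩, hεN⟩ := exists_subset_nhds_of_isCompact
    (V := fun ε : {ε // ε ∈ 𝓤 X} => closure {q : X × X | ∃ t : M, t • q ∈ ε.1})
    (fun a b => ⟨⟨a.1 ∩ b.1, inter_mem a.2 b.2⟩,
      closure_mono fun q ⟨t, ht⟩ => ⟨t, ht.1⟩, closure_mono fun q ⟨t, ht⟩ => ⟨t, ht.2⟩⟩)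
    (fun _ => isClosed_closure.isCompact) (U := N) (fun p hp => hN.mem_nhds (hQN
      (mem_SFRegionallyProximal.2 fun ε hε => mem_iInter.1 hp ⟨ε, hε⟩)))
  refine ⟨interior ε, interior_mem_uniformity hε, isOpen_interior, fun p hp t => ?_⟩
  obtain ⟨r, hr⟩ := hd.exists_smul_smul_mem isOpen_interior (t := (1 : M)) (by rwa [one_smul]) t
  exact hεN (subset_closure ⟨r, interior_subset hr⟩)

/-- Regionally proximal points are identified in every equicontinuous factor. -/
lemma SFDistal.eq_of_mem_SFRegionallyProximal (hd : SFDistal M X) {Y : Type*} [UniformSpace Y]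
    [T2Space Y] [SMul M Y] {π : X → Y} (hπ : Continuous π)
    (hequiv : ∀ (t : M) (x : X), π (t • x) = t • π x) (heq : SFEquicontinuous M Y)
    {x y : X} (h : (x, y) ∈ SFRegionallyProximal M X) : π x = π y := by
  have hππ : Continuous (Prod.map π π) := hπ.prodMap hπ
  refine eq_of_uniformity_basis uniformity_hasBasis_closed fun {η} ⟨hη, hηc⟩ => ?_
  obtain ⟨δ, hδ, hδη⟩ := heq η hη
  have hδ' : Prod.map π π ⁻¹' δ ∈ 𝓤 X := CompactSpace.uniformContinuous_of_continuous hπ hδ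
  refine closure_minimal ?_ (hηc.preimage hππ)
    (mem_SFRegionallyProximal.1 h _ (interior_mem_uniformity hδ'))
  rintro p ⟨t, ht⟩
  have hp : p ∈ closure (orbitSet M (t • p)) :=
    hd.mem_closure_orbitSet_symm (subset_closure ⟨t, rfl⟩)
  refine closure_minimal ?_ (hηc.preimage hππ) hp
  rintro _ ⟨s, rfl⟩
  have := hδη _ (interior_subset (s := Prod.map π π ⁻¹' δ) ht) s
  simpa [← hequiv, Prod.map] using this

end RegionallyProximal

/-- In a minimal distal semiflow, the quotient by the regionally proximal relation is an
equicontinuous factor. -/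
lemma SFDistal.isEqFactorRel_SFRegionallyProximal {T : Type*} {X : Type u} [Monoid T]
    [TopologicalSpace T] [UniformSpace X] [CompactSpace X] [T2Space X]
    [MulAction T X] [ContinuousSMul T X] (hmin : SFMinimal T X) (hd : SFDistal T X) :
    SFIsEqFactorRel T X (SFRegionallyProximal T X) := by
  let Y := Quotient (hd.rpSetoid hmin)
  let π : X → Y := Quotient.mk (hd.rpSetoid hmin)
  have hπ : IsOpenQuotientMap π := hd.isOpenQuotientMap_mk hmin
  have hfib : SFRegionallyProximal T X = {p : X × X | π p.1 = π p.2} :=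
    ext fun p => (Quotient.eq (r := hd.rpSetoid hmin) (x := p.1) (y := p.2)).symm
  have hT2 : T2Space Y := (t2Space_iff_of_isOpenQuotientMap hπ).2
    (hfib ▸ isClosed_SFRegionallyProximal)
  let _ : UniformSpace Y := uniformSpaceOfCompactR1
  let _ : MulAction T Y :=
    { smul := fun t => Quotient.map (fun x => t • x)
        fun _ _ h => hd.smul_mem_SFRegionallyProximal h t
      one_smul := by rintro ⟨x⟩; exact congrArg π (one_smul T x)
      mul_smul := by rintro s t ⟨x⟩; exact congrArg π (mul_smul s t x) }
  have hequiv : ∀ (t : T) (x : X), π (t • x) = t • π x := fun _ _ => rfl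
  have hcont : ContinuousSMul T Y := ⟨by
    have hq : IsOpenQuotientMap (Prod.map (id : T → T) π) := IsOpenQuotientMap.id.prodMap hπ
    exact hq.continuous_comp_iff.1 (hπ.continuous.comp continuous_smul)⟩
  refine ⟨Y, inferInstance, inferInstance, hT2, inferInstance, hcont, π, hπ.continuous,
    hπ.surjective, hequiv, fun ε hε => ?_, hfib⟩
  have hππ : IsOpenQuotientMap (Prod.map π π) := hπ.prodMap hπ
  obtain ⟨δ, hδ, hδo, hδN⟩ := hd.exists_entourage_smul_mem
    (isOpen_interior.preimage hππ.continuous) (N := Prod.map π π ⁻¹' interior ε) (by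
      rw [hfib]
      exact fun p hp => mem_uniformity_of_eq (s := interior ε) (interior_mem_uniformity hε) hp)
  refine ⟨Prod.map π π '' δ, ?_, ?_⟩
  · rw [← nhdsSet_diagonal_eq_uniformity, (hππ.isOpenMap δ hδo).mem_nhdsSet]
    rintro ⟨a, _⟩ ⟨⟩
    obtain ⟨x, rfl⟩ := hπ.surjective a
    exact ⟨(x, x), mem_uniformity_of_eq hδ rfl, rfl⟩
  · rintro _ ⟨p, hp, rfl⟩ t
    exact interior_subset (hδN p hp t)

/-- For a minimal distal semiflow `(T,X)`, the equicontinuous structure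
relation equals the regionally proximal relation: `S_eq(X) = Q(X)`. -/
theorem stmt1 (T : Type*) (X : Type u) [Monoid T] [TopologicalSpace T]
    [UniformSpace X] [CompactSpace X] [T2Space X]
    [MulAction T X] [ContinuousSMul T X]
    (hmin : SFMinimal T X) (hdist : SFDistal T X)
    (S : Set (X × X)) (hS : SFIsEqStructureRel T X S) :
    S = SFRegionallyProximal T X := by
  refine (hS.2 _ (hdist.isEqFactorRel_SFRegionallyProximal hmin)).antisymm ?_
  obtain ⟨Y, _, _, _, _, _, π, hπ, -, hequiv, heq, rfl⟩ := hS.1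
  exact fun p hp => hdist.eq_of_mem_SFRegionallyProximal hπ hequiv heq hp
end

section
/- Let (T,X) be a minimal semiflow which admits an invariant measure. Then the following conditions are pairwise equivalent: (1) (T,X) is weak-mixing; (2) the product semiflow (T, Xⁿ) is topologically transitive for every integer n ≥ 2; (3) for all nonempty open U,V ⊆ X the set N_T(U,V) = {t ∈ T : U ∩ t⁻¹V ≠ ∅} is discretely thick in T; (4) for every index set I with at least two elements, the product semiflow (T, X^I) is weak-mixing. -/
open Filter Topology Set Function MeasureTheory
open scoped Uniformity symmDiff

universe u v

/-- `(T,Y)` carries an invariant, strictly positive linear functional on `C(Y, ℝ)`; by Riesz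
representation, an invariant regular Borel measure with full support. -/
def HasInvariantFunctional (T : Type*) (Y : Type*) [Monoid T] [TopologicalSpace Y]
    [MulAction T Y] [ContinuousConstSMul T Y] : Prop :=
  ∃ Λ : C(Y, ℝ) →ₗ[ℝ] ℝ, (∀ f, 0 ≤ f → 0 ≤ Λ f) ∧ (∀ f, 0 ≤ f → Λ f = 0 → f = 0) ∧
    ∀ (t : T) (f : C(Y, ℝ)), Λ (f.comp ⟨fun y => t • y, continuous_const_smul t⟩) = Λ f

theorem SFTopTransitive.of_surjective {T Y Z : Type*} [SMul T Y] [SMul T Z]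
    [TopologicalSpace Y] [TopologicalSpace Z] (h : SFTopTransitive T Y) {π : Y → Z}
    (hc : Continuous π) (hs : Surjective π) (he : ∀ (t : T) y, π (t • y) = t • π y) :
    SFTopTransitive T Z := by
  intro U V hU hUn hV hVn
  obtain ⟨t, y, hyU, hyV⟩ := h (π ⁻¹' U) (π ⁻¹' V) (hU.preimage hc) (hUn.preimage hs)
    (hV.preimage hc) (hVn.preimage hs)
  exact ⟨t, π y, hyU, by simpa [he] using hyV⟩

theorem SFMinimal.topTransitive {T X : Type*} [SMul T X] [TopologicalSpace X]
    (h : SFMinimal T X) : SFTopTransitive T X := by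
  rintro U V - ⟨x, hx⟩ hV hVn
  obtain ⟨-, hy, t, rfl⟩ := (h x).inter_open_nonempty V hV hVn
  exact ⟨t, x, hx, hy⟩

/-- In a compact minimal semiflow, finitely many preimages of a nonempty open set cover. -/
theorem SFMinimal.exists_finset_cover {T X : Type*} [Monoid T] [TopologicalSpace X]
    [CompactSpace X] [MulAction T X] [ContinuousConstSMul T X] (h : SFMinimal T X)
    {V : Set X} (hV : IsOpen V) (hVn : V.Nonempty) :
    ∃ F : Finset T, ∀ x : X, ∃ t ∈ F, t • x ∈ V := by
  obtain ⟨F, hF⟩ := isCompact_univ.elim_finite_subcover (fun t : T => (fun x : X => t • x) ⁻¹' V)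
    (fun t => hV.preimage (continuous_const_smul t)) (fun x _ => by
      obtain ⟨-, hy, t, rfl⟩ := (h x).inter_open_nonempty V hV hVn
      exact mem_iUnion.2 ⟨t, hy⟩)
  exact ⟨F, fun x => by simpa using hF (mem_univ x)⟩

section InvariantMeasure

variable {T X : Type*} [Monoid T] [TopologicalSpace X] [CompactSpace X] [MulAction T X]
  [ContinuousConstSMul T X] [MeasurableSpace X] [BorelSpace X] {μ : Measure X}

theorem SFMinimal.isOpenPosMeasure_s3 (h : SFMinimal T X) (hμ : SFInvariantMeasure T μ) :
    μ.IsOpenPosMeasure := by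
  refine ⟨fun V hV hVn h0 => ?_⟩
  obtain ⟨F, hF⟩ := h.exists_finset_cover hV hVn
  have := hμ.1
  have h1 : μ (⋃ t ∈ F, (fun x : X => t • x) ⁻¹' V) = 0 :=
    (measure_biUnion_null_iff F.countable_toSet).2 fun t _ => by
      rw [hμ.2 t V hV.measurableSet, h0]
  have h2 : (⋃ t ∈ F, (fun x : X => t • x) ⁻¹' V) = univ :=
    eq_univ_of_forall fun x => by simpa using hF x
  rw [h2, measure_univ] at h1
  exact one_ne_zero h1

/-- A minimal semiflow with an invariant measure is surjective. -/
theorem SFMinimal.surjective_smul [T2Space X] (h : SFMinimal T X)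
    (hμ : SFInvariantMeasure T μ) (t : T) : Surjective fun x : X => t • x := by
  have := hμ.1
  have := h.isOpenPosMeasure_s3 hμ
  have hcl : IsClosed (range fun x : X => t • x) :=
    (isCompact_range (continuous_const_smul t)).isClosed
  have h1 : μ (range fun x : X => t • x) = 1 := by
    rw [← hμ.2 t _ hcl.measurableSet, preimage_range, measure_univ]
  have h2 : μ (range fun x : X => t • x)ᶜ = 0 := (prob_compl_eq_zero_iff hcl.measurableSet).2 h1
  rw [hcl.isOpen_compl.measure_eq_zero_iff μ] at h2
  exact range_eq_univ.1 (compl_empty_iff.1 h2)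

theorem SFMinimal.hasInvariantFunctional (h : SFMinimal T X)
    (hμ : SFInvariantMeasure T μ) : HasInvariantFunctional T X := by
  have := hμ.1
  have := h.isOpenPosMeasure_s3 hμ
  have hi (f : C(X, ℝ)) : Integrable f μ :=
    f.continuous.integrable_of_hasCompactSupport (HasCompactSupport.of_compactSpace _)
  refine ⟨{ toFun := fun f => ∫ x, f x ∂μ
            map_add' := fun f g => integral_add (hi f) (hi g)
            map_smul' := fun c f => integral_const_mul c _ },
    fun f hf => integral_nonneg hf, fun f hf h0 => ?_, fun t f => ?_⟩
  · by_contra hne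
    obtain ⟨x, hx⟩ := DFunLike.ne_iff.1 hne
    exact (f.continuous.integral_pos_of_hasCompactSupport_nonneg_nonzero
      (HasCompactSupport.of_compactSpace _) hf hx).ne' h0
  · have hm : Measurable fun x : X => t • x := (continuous_const_smul t).measurable
    have hmap : μ.map (fun x : X => t • x) = μ :=
      Measure.ext fun B hB => by rw [Measure.map_apply hm hB, hμ.2 t B hB]
    have := integral_map (μ := μ) hm.aemeasurable (f := f)
      f.continuous.measurable.aestronglyMeasurable
    rw [hmap] at this
    exact this.symm

end InvariantMeasure

theorem HasInvariantFunctional.of_surjective {T Y Z : Type*} [Monoid T] [TopologicalSpace Y]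
    [TopologicalSpace Z] [MulAction T Y] [MulAction T Z] [ContinuousConstSMul T Y]
    [ContinuousConstSMul T Z] (h : HasInvariantFunctional T Y) {π : Y → Z}
    (hc : Continuous π) (hs : Surjective π) (he : ∀ (t : T) y, π (t • y) = t • π y) :
    HasInvariantFunctional T Z := by
  obtain ⟨Λ, hpos, hstrict, hinv⟩ := h
  refine ⟨{ toFun := fun f => Λ (f.comp ⟨π, hc⟩)
            map_add' := fun f g => map_add Λ (f.comp ⟨π, hc⟩) (g.comp ⟨π, hc⟩)
            map_smul' := fun c f => map_smul Λ c (f.comp ⟨π, hc⟩) },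
    fun f hf => hpos _ fun y => hf _, fun f hf h0 => ?_, fun t f => ?_⟩
  · have := hstrict (f.comp ⟨π, hc⟩) (fun y => hf _) h0
    ext z
    obtain ⟨y, rfl⟩ := hs z
    exact DFunLike.congr_fun this y
  · refine Eq.trans (congrArg Λ ?_) (hinv t (f.comp ⟨π, hc⟩))
    ext y
    simp [he]

theorem HasInvariantFunctional.of_subsingleton (T Y : Type*) [Monoid T] [TopologicalSpace Y]
    [MulAction T Y] [ContinuousConstSMul T Y] [Subsingleton Y] [Nonempty Y] :
    HasInvariantFunctional T Y := by
  obtain ⟨y⟩ := ‹Nonempty Y›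
  refine ⟨{ toFun := fun f => f y, map_add' := fun _ _ => rfl, map_smul' := fun _ _ => rfl },
    fun f hf => hf y, fun f _ h0 => ?_, fun t f => congrArg f (Subsingleton.elim _ _)⟩
  ext z
  rw [Subsingleton.elim z y]
  exact h0

theorem HasInvariantFunctional.prod {T X Y : Type*} [Monoid T] [TopologicalSpace X]
    [CompactSpace X] [TopologicalSpace Y] [MulAction T X] [MulAction T Y]
    [ContinuousConstSMul T X] [ContinuousConstSMul T Y]
    (hX : HasInvariantFunctional T X) (hY : HasInvariantFunctional T Y) :
    HasInvariantFunctional T (X × Y) := by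
  obtain ⟨Λ, hpos, hstrict, hinv⟩ := hX
  obtain ⟨M, mpos, mstrict, minv⟩ := hY
  have hbound (f : C(X, ℝ)) : ‖Λ f‖ ≤ Λ 1 * ‖f‖ := by
    have h1 : 0 ≤ Λ (‖f‖ • (1 : C(X, ℝ)) - f) := hpos _ fun x => by
      simpa using (le_abs_self _).trans (f.norm_coe_le_norm x)
    have h2 : 0 ≤ Λ (‖f‖ • (1 : C(X, ℝ)) + f) := hpos _ fun x => by
      have := neg_le_of_abs_le (f.norm_coe_le_norm x)
      simp
      linarith
    rw [map_sub, map_smul, smul_eq_mul] at h1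
    rw [map_add, map_smul, smul_eq_mul] at h2
    rw [Real.norm_eq_abs, abs_le]
    constructor <;> linarith
  have hcont : Continuous Λ := (Λ.mkContinuous _ hbound).continuous
  let S (f : C(X × Y, ℝ)) : C(Y, C(X, ℝ)) := (f.comp ⟨Prod.swap, continuous_swap⟩).curry
  let L (f : C(X × Y, ℝ)) : C(Y, ℝ) := ⟨fun y => Λ (S f y), hcont.comp (S f).continuous⟩
  have hL (f : C(X × Y, ℝ)) (hf : 0 ≤ f) : 0 ≤ L f := fun y => hpos _ fun x => hf (x, y)
  refine ⟨{ toFun := fun f => M (L f)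
            map_add' := fun f g => ?_
            map_smul' := fun c f => ?_ },
    fun f hf => mpos _ (hL f hf), fun f hf h0 => ?_, fun t f => ?_⟩
  · rw [← map_add]
    refine congrArg M (ContinuousMap.ext fun y => ?_)
    exact (congrArg Λ (by ext; rfl)).trans (map_add Λ (S f y) (S g y))
  · rw [RingHom.id_apply, ← map_smul]
    refine congrArg M (ContinuousMap.ext fun y => ?_)
    exact (congrArg Λ (by ext; rfl)).trans (map_smul Λ c (S f y))
  · ext ⟨x, y⟩
    have h1 : Λ (S f y) = 0 := DFunLike.congr_fun (mstrict _ (hL f hf) h0) y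
    exact DFunLike.congr_fun (hstrict (S f y) (fun x => hf (x, y)) h1) x
  · refine Eq.trans (congrArg M (ContinuousMap.ext fun y => ?_)) (minv t (L f))
    exact Eq.trans (congrArg Λ (by ext; rfl)) (hinv t (S f (t • y)))

/-- The measure form of `HasInvariantFunctional`. -/
theorem HasInvariantFunctional.exists_measure {T Y : Type*} [Monoid T] [TopologicalSpace Y]
    [CompactSpace Y] [T2Space Y] [MulAction T Y] [ContinuousConstSMul T Y]
    [MeasurableSpace Y] [BorelSpace Y] (h : HasInvariantFunctional T Y) :
    ∃ ρ : Measure Y, IsFiniteMeasure ρ ∧ ρ.Regular ∧ ρ.IsOpenPosMeasure ∧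
      ∀ t : T, ρ.map (fun y => t • y) = ρ := by
  obtain ⟨Λ, hpos, hstrict, hinv⟩ := h
  let Λ' : CompactlySupportedContinuousMap Y ℝ →ₚ[ℝ] ℝ :=
    { toFun := fun f => Λ f.toContinuousMap
      map_add' := fun f g => map_add Λ f.toContinuousMap g.toContinuousMap
      map_smul' := fun c f => map_smul Λ c f.toContinuousMap
      monotone' := fun f g hfg => by
        have := hpos (g.toContinuousMap - f.toContinuousMap) fun y => sub_nonneg.2 (hfg y)
        rwa [map_sub, sub_nonneg] at this }
  have hint (f : C(Y, ℝ)) : ∫ y, f y ∂(RealRMK.rieszMeasure Λ') = Λ f :=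
    RealRMK.integral_rieszMeasure Λ' ⟨f, HasCompactSupport.of_compactSpace _⟩
  refine ⟨RealRMK.rieszMeasure Λ', inferInstance, inferInstance, ⟨fun U hU hUn h0 => ?_⟩,
    fun t => ?_⟩
  · obtain ⟨y, hy⟩ := hUn
    obtain ⟨f, hf0, hf1, hf⟩ := exists_continuous_zero_one_of_isClosed hU.isClosed_compl
      isClosed_singleton (disjoint_singleton_right.2 fun h => h hy)
    have hae : (f : Y → ℝ) =ᵐ[RealRMK.rieszMeasure Λ'] 0 :=
      measure_mono_null (fun z hz => by_contra fun hzU => hz (hf0 hzU)) h0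
    have hΛ : Λ f = 0 := by rw [← hint, integral_congr_ae hae]; simp
    have hfy : f y = 1 := hf1 rfl
    rw [hstrict f (fun z => (hf z).1) hΛ] at hfy
    exact zero_ne_one hfy
  · have hc : Continuous fun y : Y => t • y := continuous_const_smul t
    have := Measure.InnerRegularCompactLTTop.map_of_continuous
      (μ := RealRMK.rieszMeasure Λ') hc
    refine Measure.ext_of_integral_eq_on_compactlySupported fun f => ?_
    refine (integral_map hc.measurable.aemeasurable
      f.continuous.measurable.aestronglyMeasurable).trans ?_
    exact (hint (f.toContinuousMap.comp ⟨_, hc⟩)).trans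
      ((hinv t f.toContinuousMap).trans (hint f.toContinuousMap).symm)

/-- Upper semicontinuity of the measure of the fibres of a closed set. -/
theorem IsClosed.isOpen_setOf_measure_fiber_lt {Z Y : Type*} [TopologicalSpace Z]
    [TopologicalSpace Y] [CompactSpace Y] [MeasurableSpace Y] {ρ : Measure Y}
    [ρ.OuterRegular] {J : Set (Z × Y)} (hJ : IsClosed J) (a : ENNReal) :
    IsOpen {z : Z | ρ {y | (z, y) ∈ J} < a} := by
  refine isOpen_iff_mem_nhds.2 fun z hz => ?_
  obtain ⟨O, hJO, hO, hOa⟩ := Set.exists_isOpen_lt_of_lt _ a hz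
  have hcl : IsClosed (Prod.fst '' (J ∩ Prod.snd ⁻¹' Oᶜ)) :=
    isClosedMap_fst_of_compactSpace _ (hJ.inter (hO.isClosed_compl.preimage continuous_snd))
  refine mem_of_superset (hcl.isOpen_compl.mem_nhds ?_) fun w hw => ?_
  · rintro ⟨⟨w, y⟩, ⟨hwJ, hyO⟩, rfl⟩
    exact hyO (hJO hwJ)
  · refine (measure_mono fun y hy => ?_).trans_lt hOa
    by_contra hyO
    exact hw ⟨(w, y), ⟨hy, hyO⟩, rfl⟩

/-- McMahon's lemma: for a minimal weak-mixing `X`, the fibres over `X` of a closed invariant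
subset of `X × Y` all agree up to null sets of an invariant measure on `Y`. -/
theorem SFMinimal.measure_fiber_diff_eq_zero {T X Y : Type*} [Monoid T] [TopologicalSpace X]
    [TopologicalSpace Y] [CompactSpace Y] [MulAction T X] [MulAction T Y]
    [ContinuousConstSMul T X] [ContinuousConstSMul T Y] [MeasurableSpace Y] [BorelSpace Y]
    (hmin : SFMinimal T X) (hwm : SFWeakMixing T X) {ρ : Measure Y} [IsFiniteMeasure ρ]
    [ρ.OuterRegular] (hρ : ∀ t : T, ρ.map (fun y => t • y) = ρ) {J : Set (X × Y)}
    (hJ : IsClosed J) (hJT : ∀ (t : T), ∀ p ∈ J, t • p ∈ J) (x x' : X) :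
    ρ ({y | (x, y) ∈ J} \ {y | (x', y) ∈ J}) = 0 := by
  have hJm (z : X) : MeasurableSet {y | (z, y) ∈ J} :=
    (hJ.preimage (Continuous.prodMk_right z)).measurableSet
  have hpre (t : T) {B : Set Y} (hB : MeasurableSet B) : ρ ((fun y => t • y) ⁻¹' B) = ρ B := by
    rw [← Measure.map_apply (continuous_const_smul t).measurable hB, hρ]
  have hle (z w : X) : ρ {y | (w, y) ∈ J} ≤ ρ {y | (z, y) ∈ J} := by
    by_contra! hlt
    obtain ⟨-, hy, t, rfl⟩ := (hmin w).inter_open_nonempty _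
      (hJ.isOpen_setOf_measure_fiber_lt (ρ := ρ) _) ⟨z, hlt⟩
    suffices ρ {y | (w, y) ∈ J} ≤ ρ {y | (t • w, y) ∈ J} from this.not_gt hy
    rw [← hpre t (hJm (t • w))]
    exact measure_mono fun y hyJ => hJT t _ hyJ
  set c := ρ {y | (x, y) ∈ J}
  have hconst (z : X) : ρ {y | (z, y) ∈ J} = c := le_antisymm (hle _ _) (hle _ _)
  let K : Set ((X × X) × Y) := {q | (q.1.1, q.2) ∈ J ∧ (q.1.2, q.2) ∈ J}
  have hK : IsClosed K := (hJ.preimage (f := fun q : (X × X) × Y => (q.1.1, q.2))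
    (by fun_prop)).inter (hJ.preimage (f := fun q : (X × X) × Y => (q.1.2, q.2)) (by fun_prop))
  have hinter : c ≤ ρ {y | ((x, x'), y) ∈ K} := by
    refine ENNReal.le_of_forall_pos_le_add fun ε hε _ => ?_
    have hε' : (ε : ENNReal) ≠ 0 := by exact_mod_cast hε.ne'
    obtain ⟨O, hJO, hO, hOc⟩ := Set.exists_isOpen_lt_of_lt {y | (x, y) ∈ J} (c + ε)
      (ENNReal.lt_add_right (measure_ne_top ρ _) hε')
    have hcl : IsClosed (Prod.fst '' (J ∩ Prod.snd ⁻¹' Oᶜ)) :=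
      isClosedMap_fst_of_compactSpace _ (hJ.inter (hO.isClosed_compl.preimage continuous_snd))
    set W := (Prod.fst '' (J ∩ Prod.snd ⁻¹' Oᶜ))ᶜ
    have hxW : x ∈ W := by
      rintro ⟨⟨w, y⟩, ⟨hwJ, hyO⟩, rfl⟩
      exact hyO (hJO hwJ)
    have hWO {w : X} (hw : w ∈ W) : {y | (w, y) ∈ J} ⊆ O := fun y hy => by
      by_contra hyO
      exact hw ⟨(w, y), ⟨hy, hyO⟩, rfl⟩
    by_contra! hlt
    obtain ⟨t, ⟨z, w⟩, ⟨hz, hw⟩, hzw⟩ := hwm (W ×ˢ W)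
      {p | ρ {y | (p, y) ∈ K} < c - ε} (hcl.isOpen_compl.prod hcl.isOpen_compl)
      ⟨(x, x), hxW, hxW⟩ (hK.isOpen_setOf_measure_fiber_lt _)
      ⟨(x, x'), lt_tsub_iff_right.2 hlt⟩
    have hKm : MeasurableSet {y | (t • (z, w), y) ∈ K} :=
      (hK.preimage (Continuous.prodMk_right _)).measurableSet
    have h1 : ρ ({y | (z, y) ∈ J} ∩ {y | (w, y) ∈ J}) ≤ ρ {y | (t • (z, w), y) ∈ K} := by
      rw [← hpre t hKm]
      exact measure_mono fun y hy => ⟨hJT t _ hy.1, hJT t _ hy.2⟩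
    have h2 := measure_union_add_inter (μ := ρ) {y | (z, y) ∈ J} (hJm w)
    rw [hconst, hconst] at h2
    have h3 : ρ ({y | (z, y) ∈ J} ∪ {y | (w, y) ∈ J}) ≤ c + ε :=
      (measure_mono (union_subset (hWO hz) (hWO hw))).trans hOc.le
    have h4 : ρ ({y | (z, y) ∈ J} ∩ {y | (w, y) ∈ J}) + ε < c :=
      lt_tsub_iff_right.1 (h1.trans_lt hzw)
    have hfin : c ≠ ⊤ := measure_ne_top ρ _
    have h5 : c + c < c + c := calc
      c + c ≤ c + ε + ρ ({y | (z, y) ∈ J} ∩ {y | (w, y) ∈ J}) := by rw [← h2]; gcongr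
      _ = c + (ρ ({y | (z, y) ∈ J} ∩ {y | (w, y) ∈ J}) + ε) := by ring
      _ < c + c := ENNReal.add_lt_add_left hfin h4
    exact lt_irrefl _ h5
  have hsplit := measure_sdiff_add_inter (μ := ρ) {y | (x, y) ∈ J} (hJm x')
  have hle0 : ρ ({y | (x, y) ∈ J} \ {y | (x', y) ∈ J}) + c ≤ 0 + c := by
    rw [zero_add]
    calc _ ≤ _ + ρ ({y | (x, y) ∈ J} ∩ {y | (x', y) ∈ J}) := by gcongr; exact hinter
      _ = c := hsplit
  exact le_zero_iff.1 ((ENNReal.add_le_add_iff_right (measure_ne_top ρ _)).1 hle0)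

/-- The product of a minimal weak-mixing surjective semiflow with a transitive semiflow carrying
a fully supported invariant measure is transitive. -/
theorem SFTopTransitive.prod_of_weakMixing {T X Y : Type*} [Monoid T] [TopologicalSpace X]
    [TopologicalSpace Y] [CompactSpace Y] [T2Space Y] [MulAction T X]
    [MulAction T Y] [ContinuousConstSMul T X] [ContinuousConstSMul T Y]
    (hmin : SFMinimal T X) (hwm : SFWeakMixing T X)
    (hsurj : ∀ t : T, Surjective fun x : X => t • x)
    (hY : SFTopTransitive T Y) (hΛ : HasInvariantFunctional T Y) :
    SFTopTransitive T (X × Y) := by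
  borelize Y
  obtain ⟨ρ, _, _, _, hρ⟩ := hΛ.exists_measure
  rintro U V hU ⟨⟨x₀, y₀⟩, hxy₀⟩ hV ⟨⟨x₁, y₁⟩, hxy₁⟩
  let J : Set (X × Y) := closure {q | ∃ t : T, ∃ p ∈ U, t • p = q}
  have hJT (t : T) (p : X × Y) (hp : p ∈ J) : t • p ∈ J :=
    map_mem_closure (continuous_const_smul t) hp fun q ⟨s, r, hr, hq⟩ =>
      ⟨t * s, r, hr, by rw [mul_smul, hq]⟩
  have hUJ : U ⊆ J := fun p hp => subset_closure ⟨1, p, hp, one_smul _ _⟩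
  let U' : Set Y := {y | (x₀, y) ∈ U}
  have hU' : IsOpen U' := hU.preimage (Continuous.prodMk_right x₀)
  have hXU (x : X) {y : Y} (hy : y ∈ U') : (x, y) ∈ J := by
    have hopen : IsOpen (U' \ {y | (x, y) ∈ J}) :=
      hU'.sdiff (isClosed_closure.preimage (Continuous.prodMk_right x))
    have hnull : ρ (U' \ {y | (x, y) ∈ J}) = 0 := measure_mono_null
      (sdiff_subset_sdiff_left fun y hy => hUJ hy)
      (hmin.measure_fiber_diff_eq_zero hwm hρ isClosed_closure hJT x₀ x)
    rw [hopen.measure_eq_zero_iff ρ] at hnull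
    by_contra hyJ
    exact (hnull.subset ⟨hy, hyJ⟩).elim
  obtain ⟨t, y, hyU, hyV⟩ := hY U' {y | (x₁, y) ∈ V} hU' ⟨y₀, hxy₀⟩
    (hV.preimage (Continuous.prodMk_right x₁)) ⟨y₁, hxy₁⟩
  obtain ⟨x₂, rfl⟩ := hsurj t x₁
  obtain ⟨-, hqV, s, p, hp, rfl⟩ := mem_closure_iff.1 (hJT t _ (hXU x₂ hyU)) V hV hyV
  exact ⟨s, p, hp, hqV⟩

/-- All finite powers of a minimal weak-mixing semiflow with an invariant measure are
topologically transitive. -/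
theorem SFMinimal.topTransitive_fin {T X : Type*} [Monoid T] [TopologicalSpace X]
    [CompactSpace X] [T2Space X] [MulAction T X] [ContinuousConstSMul T X]
    (hmin : SFMinimal T X) (hwm : SFWeakMixing T X)
    (hsurj : ∀ t : T, Surjective fun x : X => t • x) (hX : HasInvariantFunctional T X) (n : ℕ) :
    SFTopTransitive T (Fin n → X) := by
  suffices SFTopTransitive T (Fin n → X) ∧ HasInvariantFunctional T (Fin n → X) from this.1
  induction n with
  | zero =>
    refine ⟨?_, .of_subsingleton T _⟩
    rintro U V - ⟨x, hx⟩ - ⟨y, hy⟩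
    exact ⟨1, x, hx, by rwa [mem_preimage, Subsingleton.elim (_ • x) y]⟩
  | succ n ih =>
    have hc : Continuous fun p : X × (Fin n → X) => (Fin.cons p.1 p.2 : Fin (n + 1) → X) :=
      continuous_pi fun i => by
        refine Fin.cases ?_ (fun i => ?_) i
        · simpa using continuous_fst
        · simpa using! (continuous_apply i).comp continuous_snd
    have hs : Surjective fun p : X × (Fin n → X) => (Fin.cons p.1 p.2 : Fin (n + 1) → X) :=
      fun f => ⟨(f 0, fun i => f i.succ), Fin.cons_self_tail f⟩
    have he (t : T) (p : X × (Fin n → X)) :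
        (Fin.cons (t • p).1 (t • p).2 : Fin (n + 1) → X) = t • Fin.cons p.1 p.2 := by
      ext i
      refine Fin.cases ?_ (fun i => ?_) i <;> simp
    exact ⟨(SFTopTransitive.prod_of_weakMixing hmin hwm hsurj ih.1 ih.2).of_surjective hc hs he,
      (hX.prod ih.2).of_surjective hc hs he⟩

theorem SFTopTransitive.finite_pi {T X ι : Type*} [SMul T X] [TopologicalSpace X] [Finite ι]
    (h : ∀ n : ℕ, SFTopTransitive T (Fin n → X)) : SFTopTransitive T (ι → X) := by
  obtain ⟨n, ⟨e⟩⟩ := Finite.exists_equiv_fin ι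
  exact (h n).of_surjective (π := fun f i => f (e i)) (by fun_prop)
    (fun g => ⟨g ∘ e.symm, by ext; simp⟩) fun _ _ => rfl

theorem SFTopTransitive.pi {T X : Type*} [SMul T X] [TopologicalSpace X]
    (h : ∀ n : ℕ, SFTopTransitive T (Fin n → X)) (ι : Type*) : SFTopTransitive T (ι → X) := by
  classical
  rintro U V hU ⟨a, ha⟩ hV ⟨b, hb⟩
  obtain ⟨F, u, hu, huU⟩ := isOpen_pi_iff.1 hU a ha
  obtain ⟨G, v, hv, hvV⟩ := isOpen_pi_iff.1 hV b hb
  obtain ⟨t, z, hz⟩ := SFTopTransitive.finite_pi (ι := ↥(F ∪ G)) h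
    {z | ∀ i : ↥(F ∪ G), i.1 ∈ F → z i ∈ u i} {z | ∀ i : ↥(F ∪ G), i.1 ∈ G → z i ∈ v i}
    (by
      simp only [ofPred_forall]
      exact isOpen_iInter_of_finite fun i => isOpen_iInter_of_finite fun hi =>
        (hu i hi).1.preimage (continuous_apply i))
    ⟨fun i => a i, fun i hi => (hu i hi).2⟩
    (by
      simp only [ofPred_forall]
      exact isOpen_iInter_of_finite fun i => isOpen_iInter_of_finite fun hi =>
        (hv i hi).1.preimage (continuous_apply i))
    ⟨fun i => b i, fun i hi => (hv i hi).2⟩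
  refine ⟨t, fun i => if hi : i ∈ F ∪ G then z ⟨i, hi⟩ else a i, huU fun i hi => ?_,
    hvV fun i hi => ?_⟩
  · have hi' : i ∈ F ∪ G := Finset.mem_union_left _ hi
    simpa only [dif_pos hi'] using hz.1 ⟨i, hi'⟩ hi
  · have hi' : i ∈ F ∪ G := Finset.mem_union_right _ hi
    simpa only [Pi.smul_apply, dif_pos hi'] using hz.2 ⟨i, hi'⟩ hi

theorem SFTopTransitive.weakMixing_pi {T X : Type*} [SMul T X] [TopologicalSpace X]
    (h : ∀ n : ℕ, SFTopTransitive T (Fin n → X)) (ι : Type*) : SFWeakMixing T (ι → X) :=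
  (SFTopTransitive.pi h (ι ⊕ ι)).of_surjective
    (π := fun f => (fun i => f (Sum.inl i), fun i => f (Sum.inr i))) (by fun_prop)
    (fun p => ⟨Sum.elim p.1 p.2, rfl⟩) fun _ _ => rfl

theorem SFTopTransitive.discretelyThick {T X : Type*} [Monoid T] [TopologicalSpace X]
    [MulAction T X] [ContinuousConstSMul T X] (h : ∀ n : ℕ, SFTopTransitive T (Fin n → X))
    (hsurj : ∀ t : T, Surjective fun x : X => t • x) {U V : Set X} (hU : IsOpen U)
    (hUn : U.Nonempty) (hV : IsOpen V) (hVn : V.Nonempty) :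
    DiscretelyThick T {t : T | (U ∩ (fun x => t • x) ⁻¹' V).Nonempty} := by
  intro F
  obtain ⟨a, ha⟩ := hUn
  choose b hb using fun f : F => hVn.preimage (hsurj f.1)
  obtain ⟨t, z, hzU, hzV⟩ := SFTopTransitive.finite_pi (ι := F) h
    (univ.pi fun _ => U) (univ.pi fun f => (fun x => f.1 • x) ⁻¹' V)
    (isOpen_set_pi finite_univ fun _ _ => hU) ⟨fun _ => a, fun _ _ => ha⟩
    (isOpen_set_pi finite_univ fun f _ => hV.preimage (continuous_const_smul f.1))
    ⟨b, fun f _ => hb f⟩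
  exact ⟨t, fun f hf => ⟨z ⟨f, hf⟩, hzU _ trivial,
    by simpa [mul_smul] using hzV ⟨f, hf⟩ trivial⟩⟩

theorem SFMinimal.weakMixing_of_discretelyThick {T X : Type*} [Monoid T] [TopologicalSpace X]
    [CompactSpace X] [MulAction T X] [ContinuousConstSMul T X] (hmin : SFMinimal T X)
    (h : ∀ U V : Set X, IsOpen U → U.Nonempty → IsOpen V → V.Nonempty →
      DiscretelyThick T {t : T | (U ∩ (fun x => t • x) ⁻¹' V).Nonempty}) :
    SFWeakMixing T X := by
  rintro U V hU ⟨⟨a, b⟩, hab⟩ hV ⟨⟨c, d⟩, hcd⟩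
  obtain ⟨U₁, U₂, hU₁, hU₂, ha, hb, hUU⟩ := isOpen_prod_iff.1 hU a b hab
  obtain ⟨V₁, V₂, hV₁, hV₂, hc, hd, hVV⟩ := isOpen_prod_iff.1 hV c d hcd
  obtain ⟨F, hF⟩ := hmin.exists_finset_cover hV₂ ⟨d, hd⟩
  obtain ⟨t, ht⟩ := h U₁ V₁ hU₁ ⟨a, ha⟩ hV₁ ⟨c, hc⟩ F
  obtain ⟨f, hfF, hf⟩ := hF (t • b)
  obtain ⟨x, hxU, hxV⟩ := ht f hfF
  exact ⟨f * t, (x, b), hUU ⟨hxU, hb⟩, hVV ⟨hxV, by simpa [mul_smul] using hf⟩⟩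

/-- For a minimal semiflow `(T,X)` admitting an invariant measure, the
following are pairwise equivalent: weak mixing; `(T,Xⁿ)` topologically transitive for
every `n ≥ 2`; every `N_T(U,V)` discretely thick; and `(T,X^I)` weak mixing for every
index set `I` with at least two elements. -/
theorem stmt3 (T : Type*) (X : Type u) [Monoid T] [TopologicalSpace T]
    [UniformSpace X] [CompactSpace X] [T2Space X]
    [MulAction T X] [ContinuousSMul T X]
    [MeasurableSpace X] [BorelSpace X]
    (hmin : SFMinimal T X)
    (hmeas : ∃ μ : Measure X, SFInvariantMeasure T μ) :
    (SFWeakMixing T X ↔ ∀ n : ℕ, 2 ≤ n → SFTopTransitive T (Fin n → X)) ∧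
    (SFWeakMixing T X ↔ ∀ U V : Set X, IsOpen U → U.Nonempty → IsOpen V → V.Nonempty →
        DiscretelyThick T {t : T | (U ∩ (fun x => t • x) ⁻¹' V).Nonempty}) ∧
    (SFWeakMixing T X ↔ ∀ (I : Type v), (∃ i j : I, i ≠ j) → SFWeakMixing T (I → X)) := by
  obtain ⟨μ, hμ⟩ := hmeas
  have hsurj := hmin.surjective_smul hμ
  have hfin (hwm : SFWeakMixing T X) : ∀ n : ℕ, SFTopTransitive T (Fin n → X) :=
    hmin.topTransitive_fin hwm hsurj (hmin.hasInvariantFunctional hμ)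
  refine ⟨⟨fun h n _ => hfin h n, fun h => ?_⟩,
    ⟨fun h U V hU hUn hV hVn => SFTopTransitive.discretelyThick (hfin h) hsurj hU hUn hV hVn,
      hmin.weakMixing_of_discretelyThick⟩,
    ⟨fun h I _ => .weakMixing_pi (hfin h) I, fun h => ?_⟩⟩
  · exact (h 2 le_rfl).of_surjective (π := fun f => (f 0, f 1)) (by fun_prop)
      (fun p => ⟨![p.1, p.2], rfl⟩) fun _ _ => rfl
  · have hI := h (ULift Bool) ⟨⟨true⟩, ⟨false⟩, by simp⟩
    exact SFTopTransitive.of_surjective hI (π := fun f => (f.1 ⟨true⟩, f.2 ⟨true⟩))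
      (by fun_prop) (fun p => ⟨(fun _ => p.1, fun _ => p.2), rfl⟩) fun _ _ => rfl
end

section
/- Let π : (T,X) → (T,Y) be an epimorphism of semiflows, where (T,X) has a dense set of minimal points and (T,Y) is minimal and invertible. Then for every entourage ε of X, the set (π × π)(T⁻¹ε) is an entourage of Y, where T⁻¹ε = { (x,x′) ∈ X × X : (tx, tx′) ∈ ε for some t ∈ T }. -/
open Filter Topology Set Function MeasureTheory
open scoped Uniformity symmDiff

universe u v

/-- In a minimal semiflow, a nonempty closed invariant set is everything. -/
theorem SFMinimal.eq_univ_of_isClosed {T Y : Type*} [SMul T Y] [TopologicalSpace Y]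
    (hmin : SFMinimal T Y) {C : Set Y} (hC : IsClosed C) (hne : C.Nonempty)
    (hinv : ∀ t : T, ∀ y ∈ C, t • y ∈ C) : C = univ := by
  obtain ⟨y, hy⟩ := hne
  refine eq_univ_of_univ_subset ?_
  rw [← (hmin y).closure_eq]
  refine closure_minimal ?_ hC
  rintro _ ⟨t, rfl⟩
  exact hinv t y hy

/-- The pairs of points which are never brought `ε`-close by the action of `T`. -/
def neverClose (T : Type*) {X : Type*} [SMul T X] (ε : Set (X × X)) : Set (X × X) :=
  {p | ∀ t : T, (t • p.1, t • p.2) ∉ ε}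

section neverClose

variable {T X Y : Type*} [Monoid T] [MulAction T X]

theorem isClosed_neverClose [TopologicalSpace X] [ContinuousConstSMul T X] {ε : Set (X × X)}
    (hε : IsOpen ε) : IsClosed (neverClose T ε) := by
  simp only [neverClose, Set.ofPred_forall]
  exact isClosed_iInter fun t => (hε.preimage (by fun_prop :
    Continuous fun p : X × X => (t • p.1, t • p.2))).isClosed_compl

theorem smul_mem_neverClose {ε : Set (X × X)} {x x' : X} (h : (x, x') ∈ neverClose T ε) (s : T) :
    (s • x, s • x') ∈ neverClose T ε := fun t => by
  simpa only [mul_smul] using h (t * s)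

/-- Over a minimal base, if one fiber contains a family of points that pairwise never become
`ε`-close, then so does every fiber. -/
theorem exists_family_neverClose_of_sfMinimal [TopologicalSpace X] [CompactSpace X]
    [ContinuousConstSMul T X] [SMul T Y] [TopologicalSpace Y] [T2Space Y] {π : X → Y}
    (hπ : Continuous π) (hequiv : ∀ (t : T) (x : X), π (t • x) = t • π x)
    (hmin : SFMinimal T Y) {ε : Set (X × X)} (hε : IsOpen ε) {ι : Type*}
    (h : ∃ (y : Y) (f : ι → X), (∀ i, π (f i) = y) ∧
      ∀ i j, i ≠ j → (f i, f j) ∈ neverClose T ε) (y : Y) :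
    ∃ f : ι → X, (∀ i, π (f i) = y) ∧ ∀ i j, i ≠ j → (f i, f j) ∈ neverClose T ε := by
  let C : Set (Y × (ι → X)) :=
    {q | (∀ i, π (q.2 i) = q.1) ∧ ∀ i j, i ≠ j → (q.2 i, q.2 j) ∈ neverClose T ε}
  have hC : IsClosed C := by
    simp only [C, Set.ofPred_and, Set.ofPred_forall]
    refine .inter (isClosed_iInter fun i => isClosed_eq (by fun_prop) (by fun_prop)) ?_
    exact isClosed_iInter fun i => isClosed_iInter fun j => isClosed_iInter fun _ =>
      (isClosed_neverClose hε).preimage (by fun_prop :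
        Continuous fun q : Y × (ι → X) => (q.2 i, q.2 j))
  have himg : Prod.fst '' C = univ := by
    refine hmin.eq_univ_of_isClosed (isClosedMap_fst_of_compactSpace _ hC) ?_ ?_
    · obtain ⟨y, f, hf⟩ := h
      exact ⟨y, (y, f), hf, rfl⟩
    · rintro t _ ⟨⟨y, f⟩, hf, rfl⟩
      refine ⟨(t • y, fun i => t • f i), ⟨fun i => ?_, fun i j hij => ?_⟩, rfl⟩
      · exact (hequiv t _).trans (congrArg _ (hf.1 i))
      · exact smul_mem_neverClose (hf.2 i j hij) t
  obtain ⟨⟨_, f⟩, hf, rfl⟩ := himg.symm ▸ mem_univ y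
  exact ⟨f, hf⟩

/-- A family of points that pairwise never become `ε`-close has bounded cardinality. -/
theorem exists_bound_family_neverClose [UniformSpace X] [CompactSpace X] {ε : Set (X × X)}
    (hε : ε ∈ 𝓤 X) :
    ∃ N : ℕ, ∀ f : Fin N → X, ∃ i j, i ≠ j ∧ (f i, f j) ∉ neverClose T ε := by
  obtain ⟨δ, hδ, hsymm, hδε⟩ := comp_symm_mem_uniformity_sets hε
  obtain ⟨s, hs, hcov⟩ := (isCompact_univ (X := X)).totallyBounded δ hδ
  have := hs.to_subtype
  have := Fintype.ofFinite s
  refine ⟨Fintype.card s + 1, fun f => ?_⟩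
  have hc (i) : ∃ c : s, (f i, (c : X)) ∈ δ := by simpa using hcov (mem_univ (f i))
  choose c hc using hc
  obtain ⟨i, j, hij, hcij⟩ := Fintype.exists_ne_map_eq_of_card_lt c (by simp)
  refine ⟨i, j, hij, fun h => h 1 ?_⟩
  simp only [one_smul]
  exact hδε ⟨c i, hc i, hsymm.symm _ _ (hcij ▸ hc j)⟩

/-- If the fibers over some pairs of points of `Y` arbitrarily close to `(y₀, y₀)` never become
`ε`-close, then families of points of a fiber that pairwise never become `ε`-close can be
doubled. -/
theorem exists_sum_family_neverClose [TopologicalSpace X] [CompactSpace X]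
    [ContinuousConstSMul T X] [TopologicalSpace Y] [T2Space Y] {π : X → Y} (hπ : Continuous π)
    {ε : Set (X × X)} (hε : IsOpen ε) (hε_symm : ∀ x x', (x, x') ∈ ε → (x', x) ∈ ε) {y₀ : Y}
    (hy₀ : ∃ᶠ p in 𝓝 (y₀, y₀), ∀ x x', π x = p.1 → π x' = p.2 → (x, x') ∈ neverClose T ε)
    {ι : Type*}
    (h : ∀ y : Y, ∃ f : ι → X, (∀ i, π (f i) = y) ∧
      ∀ i j, i ≠ j → (f i, f j) ∈ neverClose T ε) :
    ∃ f : ι ⊕ ι → X, (∀ i, π (f i) = y₀) ∧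
      ∀ i j, i ≠ j → (f i, f j) ∈ neverClose T ε := by
  let C : Set ((Y × Y) × (ι ⊕ ι → X)) :=
    {q | ((∀ i, π (q.2 (.inl i)) = q.1.1) ∧ ∀ i, π (q.2 (.inr i)) = q.1.2) ∧
      ∀ i j, i ≠ j → (q.2 i, q.2 j) ∈ neverClose T ε}
  have hC : IsClosed C := by
    simp only [C, Set.ofPred_and, Set.ofPred_forall]
    refine .inter (.inter ?_ ?_) ?_
    · exact isClosed_iInter fun i => isClosed_eq (by fun_prop) (by fun_prop)
    · exact isClosed_iInter fun i => isClosed_eq (by fun_prop) (by fun_prop)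
    · exact isClosed_iInter fun i => isClosed_iInter fun j => isClosed_iInter fun _ =>
        (isClosed_neverClose hε).preimage (by fun_prop :
          Continuous fun q : (Y × Y) × (ι ⊕ ι → X) => (q.2 i, q.2 j))
  have hmem : (y₀, y₀) ∈ Prod.fst '' C := by
    refine (isClosedMap_fst_of_compactSpace _ hC).mem_of_frequently_of_tendsto
      (hy₀.mono fun p hp => ?_) tendsto_id
    obtain ⟨f, hf, hf'⟩ := h p.1
    obtain ⟨g, hg, hg'⟩ := h p.2
    refine ⟨(p, Sum.elim f g), ⟨⟨hf, hg⟩, ?_⟩, rfl⟩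
    rintro (i | i) (j | j) hij
    · exact hf' i j fun e => hij (e ▸ rfl)
    · exact hp _ _ (hf i) (hg j)
    · exact fun t ht => hp _ _ (hf j) (hg i) t (hε_symm _ _ ht)
    · exact hg' i j fun e => hij (e ▸ rfl)
  obtain ⟨⟨_, f⟩, hf, rfl⟩ := hmem
  exact ⟨f, Sum.rec hf.1.1 hf.1.2, hf.2⟩

end neverClose

/-- If `π : (T,X) → (T,Y)` is an epimorphism, `(T,X)` has a dense set of
minimal points, and `(T,Y)` is minimal and invertible, then for every entourage `ε`
of `X` the set `(π × π)(T⁻¹ε)` is an entourage of `Y`. -/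
theorem stmt8 (T : Type*) (X : Type u) (Y : Type v) [Monoid T] [TopologicalSpace T]
    [UniformSpace X] [CompactSpace X] [T2Space X] [MulAction T X] [ContinuousSMul T X]
    [UniformSpace Y] [CompactSpace Y] [T2Space Y] [MulAction T Y] [ContinuousSMul T Y]
    (π : X → Y) (hcont : Continuous π) (hsurj : Function.Surjective π)
    (hequiv : ∀ (t : T) (x : X), π (t • x) = t • π x)
    (hdense : Dense {x : X | SFMinimalPoint T x})
    (hminY : SFMinimal T Y)
    (hinv : ∀ t : T, Function.Bijective fun y : Y => t • y) :
    ∀ ε ∈ 𝓤 X,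
      (fun p : X × X => (π p.1, π p.2)) ''
        {p : X × X | ∃ t : T, (t • p.1, t • p.2) ∈ ε} ∈ 𝓤 Y := by
  intro ε hε
  obtain ⟨δ, ⟨hδ, hδo, hδs⟩, hδε⟩ := uniformity_hasBasis_open_symmetric.mem_iff.1 hε
  suffices (fun p : X × X => (π p.1, π p.2)) ''
      {p : X × X | ∃ t : T, (t • p.1, t • p.2) ∈ δ} ∈ 𝓤 Y from
    mem_of_superset this (image_mono fun p ⟨t, ht⟩ => ⟨t, hδε ht⟩)
  by_contra hbad
  simp only [compactSpace_uniformity, mem_iSup, not_forall] at hbad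
  obtain ⟨y₀, hy₀⟩ := hbad
  have hfreq : ∃ᶠ p in 𝓝 (y₀, y₀),
      ∀ x x', π x = p.1 → π x' = p.2 → (x, x') ∈ neverClose T δ := by
    refine Frequently.mono (not_eventually.1 hy₀) fun p hp x x' hx hx' t ht => ?_
    exact hp ⟨(x, x'), ⟨t, ht⟩, Prod.ext hx hx'⟩
  have hfam (n : ℕ) : ∀ y : Y, ∃ f : Fin (n + 1) → X, (∀ i, π (f i) = y) ∧
      ∀ i j, i ≠ j → (f i, f j) ∈ neverClose T δ := by
    induction n with
    | zero =>
      intro y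
      obtain ⟨x, hx⟩ := hsurj y
      exact ⟨fun _ => x, fun _ => hx, fun i j hij =>
        absurd (Subsingleton.elim (α := Fin 1) i j) hij⟩
    | succ n ih =>
      obtain ⟨f, hf, hf'⟩ :=
        exists_sum_family_neverClose hcont hδo (fun x x' h => hδs.symm x x' h) hfreq ih
      obtain ⟨e⟩ : Nonempty (Fin (n + 1 + 1) ↪ Fin (n + 1) ⊕ Fin (n + 1)) :=
        Function.Embedding.nonempty_of_card_le (by simp)
      exact exists_family_neverClose_of_sfMinimal hcont hequiv hminY hδo
        ⟨y₀, f ∘ e, fun i => hf _, fun i j hij => hf' _ _ (e.injective.ne hij)⟩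
  obtain ⟨N, hN⟩ := exists_bound_family_neverClose (T := T) hδ
  obtain ⟨f, -, hf⟩ := hfam N y₀
  obtain ⟨i, j, hij, h⟩ := hN (f ∘ Fin.castSucc)
  exact h (hf _ _ ((Fin.castSucc_injective N).ne hij))
end

section
/- Let π : (T,X) → (T,Y) be an epimorphism of semiflows, where (T,X) is surjective with a dense set of minimal points and (T,Y) is invertible and minimal. Then (π × π)(Q(X)) = Q(Y), i.e. the image of the regionally proximal relation of X under π × π equals the regionally proximal relation of Y. -/
open Filter Topology Set Function MeasureTheory
open scoped Uniformity symmDiff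

universe u v

/-- The pairs of points that some element of `T` brings `ε`-close together. -/
def closePairs (T : Type*) {X : Type*} [SMul T X] (ε : Set (X × X)) : Set (X × X) :=
  {p | ∃ t : T, (t • p.1, t • p.2) ∈ ε}

theorem closePairs_mono (T : Type*) {X : Type*} [SMul T X] {ε ε' : Set (X × X)} (h : ε ⊆ ε') :
    closePairs T ε ⊆ closePairs T ε' :=
  fun _ ⟨t, ht⟩ => ⟨t, h ht⟩

theorem mem_SFRegionallyProximal_s9 {T X : Type*} [SMul T X] [UniformSpace X] {p : X × X} :
    p ∈ SFRegionallyProximal T X ↔ ∀ ε ∈ 𝓤 X, p ∈ closure (closePairs T ε) := by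
  simp only [SFRegionallyProximal, closePairs, mem_iInter]

/-- In a minimal semiflow every nonempty open set is visited by every orbit. -/
theorem SFMinimal.exists_smul_mem {T Y : Type*} [SMul T Y] [TopologicalSpace Y]
    (h : SFMinimal T Y) {O : Set Y} (hO : IsOpen O) (hne : O.Nonempty) (y : Y) :
    ∃ t : T, t • y ∈ O := by
  obtain ⟨_, hz, t, rfl⟩ := (h y).inter_open_nonempty O hO hne
  exact ⟨t, hz⟩

section

variable {T X Y : Type*} [Monoid T] {π : X → Y}

/-- The orbit closure of any point surjects onto a minimal factor. -/
theorem SFMinimal.image_closure_orbitSet [TopologicalSpace X] [CompactSpace X] [MulAction T X]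
    [TopologicalSpace Y] [T2Space Y] [MulAction T Y] (h : SFMinimal T Y)
    (hcont : Continuous π) (hequiv : ∀ (t : T) (x : X), π (t • x) = t • π x) (x : X) :
    π '' closure (orbitSet T x) = univ := by
  have hclosed : IsClosed (π '' closure (orbitSet T x)) :=
    (isClosed_closure.isCompact.image hcont).isClosed
  have hsub : orbitSet T (π x) ⊆ π '' closure (orbitSet T x) := by
    rintro _ ⟨t, rfl⟩
    exact ⟨t • x, subset_closure ⟨t, rfl⟩, hequiv t x⟩
  exact univ_subset_iff.1 ((h (π x)).closure_eq ▸ closure_minimal hsub hclosed)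

/-- A neighbourhood of a minimal point has an image containing a translate of a nonempty
open set of the minimal factor. -/
theorem SFMinimalPoint.exists_open_smul_mem_image [TopologicalSpace T] [TopologicalSpace X] [CompactSpace X]
    [MulAction T X] [ContinuousSMul T X]
    [TopologicalSpace Y] [CompactSpace Y] [T2Space Y] [MulAction T Y] [ContinuousSMul T Y]
    (hminY : SFMinimal T Y) (hcont : Continuous π)
    (hequiv : ∀ (t : T) (x : X), π (t • x) = t • π x)
    {x : X} (hx : SFMinimalPoint T x) {K : Set X} (hK : K ∈ 𝓝 x) (hKc : IsClosed K) :
    ∃ (t : T) (O : Set Y), IsOpen O ∧ O.Nonempty ∧ ∀ y ∈ O, t • y ∈ π '' K := by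
  have hcover : closure (orbitSet T x) ⊆ ⋃ t : T, (fun z => t • z) ⁻¹' interior K := by
    intro m hm
    have hxm : x ∈ closure (orbitSet T m) := by
      rw [hx m hm]
      exact subset_closure ⟨1, one_smul T x⟩
    obtain ⟨_, hz, t, rfl⟩ :=
      mem_closure_iff.1 hxm _ isOpen_interior (mem_interior_iff_mem_nhds.2 hK)
    exact mem_iUnion.2 ⟨t, hz⟩
  obtain ⟨F, hF⟩ := isClosed_closure.isCompact.elim_finite_subcover _
    (fun t : T => isOpen_interior.preimage (continuous_const_smul t)) hcover
  have hcoverY : ⋃ t : F, (fun y : Y => (t : T) • y) ⁻¹' (π '' K) = univ := by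
    refine eq_univ_of_forall fun y => ?_
    obtain ⟨m, hm, rfl⟩ : y ∈ π '' closure (orbitSet T x) := by
      rw [hminY.image_closure_orbitSet hcont hequiv x]
      trivial
    obtain ⟨t, htF, ht⟩ := mem_iUnion₂.1 (hF hm)
    exact mem_iUnion.2 ⟨⟨t, htF⟩, t • m, interior_subset ht, hequiv t m⟩
  have : Nonempty Y := ⟨π x⟩
  obtain ⟨t, ht⟩ := nonempty_interior_of_iUnion_of_closed
    (fun t : F => ((hKc.isCompact.image hcont).isClosed).preimage
      (continuous_const_smul (t : T))) hcoverY
  exact ⟨t, _, isOpen_interior, ht, fun y hy => (interior_subset hy :)⟩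

/-- Over a minimal invertible factor, pairs that get close enough together lift to pairs that
get close together. -/
theorem exists_closePairs_subset_image [TopologicalSpace T] [UniformSpace X] [CompactSpace X]
    [MulAction T X] [ContinuousSMul T X]
    [UniformSpace Y] [CompactSpace Y] [T2Space Y] [MulAction T Y] [ContinuousSMul T Y]
    (hcont : Continuous π) (hequiv : ∀ (t : T) (x : X), π (t • x) = t • π x)
    (hsurjX : ∀ t : T, Function.Surjective fun x : X => t • x)
    (hminY : SFMinimal T Y) (hinj : ∀ t : T, Function.Injective fun y : Y => t • y)
    {x : X} (hx : SFMinimalPoint T x) {ε : Set (X × X)} (hε : ε ∈ 𝓤 X) :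
    ∃ δ ∈ 𝓤 Y, closePairs T δ ⊆ Prod.map π π '' closePairs T ε := by
  obtain ⟨ε', hε', hsymm, hcomp⟩ := comp_symm_mem_uniformity_sets hε
  obtain ⟨K, hK, hKc, hKε⟩ := exists_mem_nhds_isClosed_subset (UniformSpace.ball_mem_nhds x hε')
  obtain ⟨t, O, hO, hne, hOK⟩ :=
    hx.exists_open_smul_mem_image hminY hcont hequiv hK hKc
  obtain ⟨δ, hδ, hball⟩ := lebesgue_number_lemma (K := (univ : Set Y))
    (U := fun s : T => (fun y => s • y) ⁻¹' O) isCompact_univ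
    (fun s => hO.preimage (continuous_const_smul s))
    (fun y _ => mem_iUnion.2 (hminY.exists_smul_mem hO hne y))
  refine ⟨δ, hδ, ?_⟩
  rintro ⟨y, y'⟩ ⟨r, hr⟩
  obtain ⟨s, hs⟩ := hball (r • y) trivial
  have lift : ∀ z : Y, r • z ∈ UniformSpace.ball (r • y) δ →
      ∃ w : X, π w = z ∧ (t * s * r) • w ∈ K := by
    intro z hz
    obtain ⟨u, huK, hu⟩ := hOK _ (hs hz)
    obtain ⟨w, rfl⟩ := hsurjX (t * s * r) u
    refine ⟨w, hinj (t * s * r) ?_, huK⟩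
    simpa only [hequiv, mul_smul] using hu
  obtain ⟨w, rfl, hw⟩ := lift y (UniformSpace.mem_ball_self _ hδ)
  obtain ⟨w', rfl, hw'⟩ := lift y' hr
  exact ⟨(w, w'), ⟨t * s * r, hcomp ⟨x, hsymm.symm _ _ (hKε hw), hKε hw'⟩⟩, rfl⟩

end

/-- Epimorphisms map regionally proximal pairs to regionally proximal pairs. -/
theorem image_SFRegionallyProximal_subset {T X Y : Type*} [SMul T X] [SMul T Y]
    [UniformSpace X] [CompactSpace X] [UniformSpace Y] {π : X → Y}
    (hcont : Continuous π) (hequiv : ∀ (t : T) (x : X), π (t • x) = t • π x) :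
    Prod.map π π '' SFRegionallyProximal T X ⊆ SFRegionallyProximal T Y := by
  rintro _ ⟨p, hp, rfl⟩
  refine mem_SFRegionallyProximal_s9.2 fun δ hδ => ?_
  refine map_mem_closure (hcont.prodMap hcont) (mem_SFRegionallyProximal_s9.1 hp _
    (CompactSpace.uniformContinuous_of_continuous hcont hδ)) ?_
  rintro ⟨a, b⟩ ⟨t, ht⟩
  exact ⟨t, by simpa only [mem_preimage, Prod.map_apply, hequiv] using ht⟩

/-- If `π : (T,X) → (T,Y)` is an epimorphism, `(T,X)` is surjective with a
dense set of minimal points, and `(T,Y)` is invertible and minimal, then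
`(π × π)(Q(X)) = Q(Y)`. -/
theorem stmt9 (T : Type*) (X : Type u) (Y : Type v) [Monoid T] [TopologicalSpace T]
    [UniformSpace X] [CompactSpace X] [T2Space X] [MulAction T X] [ContinuousSMul T X]
    [UniformSpace Y] [CompactSpace Y] [T2Space Y] [MulAction T Y] [ContinuousSMul T Y]
    (π : X → Y) (hcont : Continuous π) (hsurj : Function.Surjective π)
    (hequiv : ∀ (t : T) (x : X), π (t • x) = t • π x)
    (hsurjX : ∀ t : T, Function.Surjective fun x : X => t • x)
    (hdense : Dense {x : X | SFMinimalPoint T x})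
    (hminY : SFMinimal T Y)
    (hinv : ∀ t : T, Function.Bijective fun y : Y => t • y) :
    (fun p : X × X => (π p.1, π p.2)) '' SFRegionallyProximal T X
      = SFRegionallyProximal T Y := by
  change Prod.map π π '' _ = _
  refine (image_SFRegionallyProximal_subset hcont hequiv).antisymm fun q hq => ?_
  have hcont₂ : Continuous (Prod.map π π) := hcont.prodMap hcont
  obtain ⟨x₀, -⟩ := hsurj q.1
  obtain ⟨x, hx⟩ := hdense.nonempty_iff.2 ⟨x₀⟩
  let C (ε : (𝓤 X).sets) : Set (X × X) := closure (closePairs T ε.1) ∩ Prod.map π π ⁻¹' {q}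
  have hne (ε) : (C ε).Nonempty := by
    obtain ⟨δ, hδ, hsub⟩ := exists_closePairs_subset_image hcont hequiv hsurjX hminY
      (fun t => (hinv t).injective) hx ε.2
    have hclosed : IsClosed (Prod.map π π '' closure (closePairs T ε.1)) :=
      (isClosed_closure.isCompact.image hcont₂).isClosed
    obtain ⟨p, hp, hpq⟩ := closure_minimal (hsub.trans (image_mono subset_closure)) hclosed
      (mem_SFRegionallyProximal_s9.1 hq δ hδ)
    exact ⟨p, hp, hpq⟩
  have hCclosed (ε) : IsClosed (C ε) :=
    isClosed_closure.inter (isClosed_singleton.preimage hcont₂)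
  have hdir : Directed (· ⊇ ·) C := by
    intro ε ε'
    refine ⟨⟨ε.1 ∩ ε'.1, inter_mem ε.2 ε'.2⟩, ?_, ?_⟩
    · exact inter_subset_inter_left _ (closure_mono (closePairs_mono T inter_subset_left))
    · exact inter_subset_inter_left _ (closure_mono (closePairs_mono T inter_subset_right))
  have : Nonempty (𝓤 X).sets := ⟨⟨univ, univ_mem⟩⟩
  obtain ⟨p, hp⟩ := IsCompact.nonempty_iInter_of_directed_nonempty_isCompact_isClosed C hdir
    hne (fun ε => (hCclosed ε).isCompact) hCclosed
  rw [mem_iInter] at hp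
  exact ⟨p, mem_SFRegionallyProximal_s9.2 fun ε hε => (hp ⟨ε, hε⟩).1, (hp ⟨univ, univ_mem⟩).2⟩
end

section
/- Let (T,X) be a surjective minimal semiflow. Then the equicontinuous structure relation S_eq(X) is the smallest closed T-invariant equivalence relation on X containing the regionally proximal relation Q(X). -/
open Filter Topology Set Function MeasureTheory
open scoped Uniformity symmDiff

universe u v

/-- A uniformly equicontinuous sequence of maps between compact spaces has two terms which are
uniformly close to each other. -/
theorem UniformEquicontinuous.exists_lt_forall_mem {X Y : Type*} [UniformSpace X]
    [CompactSpace X] [UniformSpace Y] [CompactSpace Y] {h : ℕ → X → Y}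
    (hh : UniformEquicontinuous h) {ε : Set (Y × Y)} (hε : ε ∈ 𝓤 Y) :
    ∃ i k : ℕ, ∀ x, (h i x, h (i + k + 1) x) ∈ ε := by
  obtain ⟨W, hW, hWs, hWε⟩ := comp_symm_mem_uniformity_sets hε
  obtain ⟨V, hV, hVs, hVW⟩ := comp_symm_mem_uniformity_sets hW
  obtain ⟨t, -, ht, hXt⟩ :=
    (isCompact_univ (X := X)).totallyBounded.exists_subset (hh V hV)
  obtain ⟨s, -, hs, hYs⟩ := (isCompact_univ (X := Y)).totallyBounded.exists_subset hV
  have hY : ∀ y : Y, ∃ z : s, (y, (z : Y)) ∈ V := fun y => by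
    simpa using hYs (mem_univ y)
  choose c hc using hY
  have := ht.to_subtype
  have := hs.to_subtype
  obtain ⟨i, j, hij, heq⟩ : ∃ i j : ℕ, i < j ∧
      (fun a : t => c (h i a)) = fun a : t => c (h j a) := by
    obtain ⟨i, j, hne, heq⟩ :=
      Finite.exists_ne_map_eq_of_infinite fun (n : ℕ) (a : t) => c (h n a)
    rcases hne.lt_or_gt with hlt | hlt
    exacts [⟨i, j, hlt, heq⟩, ⟨j, i, hlt, heq.symm⟩]
  obtain ⟨k, rfl⟩ := Nat.exists_eq_add_of_lt hij
  refine ⟨i, k, fun x => ?_⟩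
  obtain ⟨a, ha, hxa⟩ : ∃ a ∈ t, ∀ n, (h n x, h n a) ∈ V := by
    simpa using hXt (mem_univ x)
  have hca : c (h i a) = c (h (i + k + 1) a) := congrFun heq ⟨a, ha⟩
  refine hWε ⟨_, hVW ⟨_, hxa i, hc _⟩, ?_⟩
  rw [hca]
  exact hVW ⟨_, hVs.symm _ _ (hc _), hVs.symm _ _ (hxa _)⟩

/-- A surjective equicontinuous semiflow on a compact space is uniformly distal. -/
theorem SFEquicontinuous.exists_forall_smul_mem {T Y : Type*} [Monoid T] [UniformSpace Y]
    [CompactSpace Y] [MulAction T Y] (heq : SFEquicontinuous T Y)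
    (hsurj : ∀ t : T, Function.Surjective fun y : Y => t • y)
    {ε : Set (Y × Y)} (hε : ε ∈ 𝓤 Y) :
    ∃ η ∈ 𝓤 Y, ∀ (t : T) (y y' : Y), (t • y, t • y') ∈ η → (y, y') ∈ ε := by
  obtain ⟨V, hV, hVs, hVε⟩ := comp_comp_symm_mem_uniformity_sets hε
  obtain ⟨η, hη, hηV⟩ := heq V hV
  refine ⟨η, hη, fun t y y' hyy' => ?_⟩
  have hh : UniformEquicontinuous fun (n : ℕ) (y : Y) => t ^ n • y := fun U hU => by
    obtain ⟨δ, hδ, hδU⟩ := heq U hU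
    exact mem_of_superset hδ fun p hp n => hδU p hp _
  obtain ⟨i, k, hik⟩ := hh.exists_lt_forall_mem hV
  have hclose : ∀ z : Y, (z, t ^ k • t • z) ∈ V := fun z => by
    obtain ⟨w, rfl⟩ := hsurj (t ^ i) z
    have := hik w
    rwa [show i + k + 1 = k + 1 + i by omega, pow_add, pow_succ, mul_smul, mul_smul] at this
  exact hVε ⟨_, ⟨_, hclose y, hηV _ hyy' _⟩, hVs.symm _ _ (hclose y')⟩

/-- Let `T` act surjectively on `X` and let `π : X → Y`. If the multivalued maps `π ∘ t⁻¹` are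
uniformly equicontinuous, then so are the maps `π ∘ t`. -/
theorem uniformEquicontinuous_comp_smul {T X Y : Type*} [Monoid T] [UniformSpace X]
    [CompactSpace X] [MulAction T X] [UniformSpace Y] [CompactSpace Y] [T0Space Y]
    (hsurj : ∀ t : T, Function.Surjective fun x : X => t • x) {π : X → Y}
    (hπ : ∀ ε ∈ 𝓤 Y, ∃ α ∈ 𝓤 X, ∀ (t : T) (x x' : X), (t • x, t • x') ∈ α → (π x, π x') ∈ ε) :
    UniformEquicontinuous fun (t : T) (x : X) => π (t • x) := by
  intro ε hε
  obtain ⟨V, hV, hVs, hVε⟩ := comp_comp_symm_mem_uniformity_sets hε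
  obtain ⟨α, hα, hαV⟩ := hπ V hV
  refine mem_of_superset hα fun ⟨x, x'⟩ hxx' t => ?_
  have hker : ∀ (s : T) (a b : X), s • a = s • b → π a = π b := fun s a b hab =>
    eq_of_uniformity fun {U} hU => by
      obtain ⟨β, hβ, hβU⟩ := hπ U hU
      exact hβU s a b (hab ▸ refl_mem_uniformity hβ)
  choose g hg using hsurj t
  replace hg : ∀ x, t • g x = x := hg
  have hgn : ∀ (n : ℕ) (x : X), t ^ n • g^[n] x = x := fun n => by
    induction n with
    | zero => simp
    | succ n ih =>
      intro x
      rw [Function.iterate_succ_apply', pow_succ, mul_smul, hg, ih]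
  have hh : UniformEquicontinuous fun (n : ℕ) (x : X) => π (g^[n] x) := fun U hU => by
    obtain ⟨β, hβ, hβU⟩ := hπ U hU
    refine mem_of_superset hβ fun p hp n => hβU (t ^ n) _ _ ?_
    rwa [hgn, hgn]
  obtain ⟨i, k, hik⟩ := hh.exists_lt_forall_mem hV
  have hclose : ∀ z : X, (π (t • z), π (g^[k] z)) ∈ V := fun z => by
    have h₁ : π (g^[i] (t ^ (i + 1) • z)) = π (t • z) :=
      hker (t ^ i) _ _ (by rw [hgn, pow_succ, mul_smul])
    have h₂ : π (g^[i + k + 1] (t ^ (i + 1) • z)) = π (g^[k] z) :=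
      hker (t ^ (i + k + 1)) _ _ (by
        rw [hgn, show i + k + 1 = i + 1 + k by omega, pow_add _ (i + 1) k, mul_smul, hgn])
    rw [← h₁, ← h₂]
    exact hik _
  refine hVε ⟨_, ⟨_, hclose x, hαV (t ^ k) _ _ ?_⟩, hVs.symm _ _ (hclose x')⟩
  rwa [hgn, hgn]

/-- The quotient of a compact Hausdorff space by a closed equivalence relation is a closed map. -/
theorem isClosedMap_quotientMk_of_isClosed {X : Type*} [TopologicalSpace X] [CompactSpace X]
    (r : Setoid X) (hr : IsClosed {p : X × X | r p.1 p.2}) :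
    IsClosedMap (Quotient.mk r) := by
  intro C hC
  refine isQuotientMap_quotient_mk'.isClosed_preimage.1 ?_
  have : Quotient.mk r ⁻¹' (Quotient.mk r '' C) =
      Prod.snd '' ({p : X × X | r p.1 p.2} ∩ Prod.fst ⁻¹' C) := by
    ext x
    simp only [mem_preimage, mem_image, mem_inter_iff, mem_ofPred_eq, Prod.exists,
      exists_eq_right]
    exact exists_congr fun a => ⟨fun ⟨ha, h⟩ => ⟨Quotient.exact h, ha⟩,
      fun ⟨h, ha⟩ => ⟨ha, Quotient.sound h⟩⟩
  exact this ▸ isClosedMap_snd_of_compactSpace _ (hr.inter (hC.preimage continuous_fst))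

/-- A closed continuous surjective image of a normal `T1` space is Hausdorff. -/
theorem IsClosedMap.t2Space_of_surjective {X Y : Type*} [TopologicalSpace X] [T4Space X]
    [TopologicalSpace Y] {f : X → Y} (hf : IsClosedMap f) (hcont : Continuous f)
    (hsurj : Function.Surjective f) : T2Space Y := by
  have hsing : ∀ y : Y, IsClosed {y} := fun y => by
    obtain ⟨x, rfl⟩ := hsurj y
    simpa using hf _ (isClosed_singleton (x := x))
  refine t2Space_iff_disjoint_nhds.2 fun y y' hyy' => ?_
  have hdisj : Disjoint (f ⁻¹' {y}) (f ⁻¹' {y'}) :=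
    Disjoint.preimage _ (disjoint_singleton.2 hyy')
  obtain ⟨U, V, hU, hV, hyU, hyV, hUV⟩ := normal_separation
    ((hsing y).preimage hcont) ((hsing y').preimage hcont) hdisj
  have h₁ := hf.eventually_nhds_fiber (p := (· ∈ U)) y fun x hx => hU.mem_nhds (hyU hx)
  have h₂ := hf.eventually_nhds_fiber (p := (· ∈ V)) y' fun x hx => hV.mem_nhds (hyV hx)
  refine Filter.disjoint_iff.2 ⟨_, h₁, _, h₂, Set.disjoint_left.2 fun z hz hz' => ?_⟩
  obtain ⟨x, rfl⟩ := hsurj z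
  exact Set.disjoint_left.1 hUV (hz x rfl) (hz' x rfl)

/-- Uniform equicontinuity descends along a continuous surjection from a compact space to a compact
Hausdorff space. -/
theorem UniformEquicontinuous.of_comp_surjective {ι X Y Z : Type*} [UniformSpace X]
    [CompactSpace X] [UniformSpace Y] [CompactSpace Y] [T2Space Y] [UniformSpace Z]
    {F : ι → Y → Z} {π : X → Y} (hπ : Continuous π) (hsurj : Function.Surjective π)
    (h : UniformEquicontinuous fun i x => F i (π x)) : UniformEquicontinuous F := by
  refine CompactSpace.uniformEquicontinuous_of_equicontinuous fun y ε hε => ?_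
  have := hπ.isProperMap.isClosedMap.eventually_nhds_fiber
    (p := fun x => ∀ i, (F i y, F i (π x)) ∈ ε) y (by
      rintro x rfl
      exact h.equicontinuous x ε hε)
  filter_upwards [this] with z hz
  obtain ⟨x, rfl⟩ := hsurj z
  exact hz x rfl

/-- If a map `π` to a compact space is constant on regionally proximal pairs, then the multivalued
maps `π ∘ t⁻¹` are uniformly equicontinuous. -/
theorem exists_forall_smul_mem_of_regionallyProximal {T X Y : Type*} [SMul T X]
    [UniformSpace X] [CompactSpace X] [UniformSpace Y] {π : X → Y} (hπ : Continuous π)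
    (hQ : ∀ p ∈ SFRegionallyProximal T X, π p.1 = π p.2) {ε : Set (Y × Y)} (hε : ε ∈ 𝓤 Y) :
    ∃ α ∈ 𝓤 X, ∀ (t : T) (x x' : X), (t • x, t • x') ∈ α → (π x, π x') ∈ ε := by
  have hne : Nonempty {α : Set (X × X) // α ∈ 𝓤 X} := ⟨⟨univ, univ_mem⟩⟩
  obtain ⟨⟨α, hα⟩, hsub⟩ := exists_subset_nhds_of_isCompact'
    (V := fun α : {α : Set (X × X) // α ∈ 𝓤 X} =>
      closure {p : X × X | ∃ t : T, (t • p.1, t • p.2) ∈ α.1})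
    (U := {p | (π p.1, π p.2) ∈ ε})
    (fun α β => ⟨⟨α.1 ∩ β.1, inter_mem α.2 β.2⟩,
      closure_mono fun p ⟨t, ht⟩ => ⟨t, ht.1⟩, closure_mono fun p ⟨t, ht⟩ => ⟨t, ht.2⟩⟩)
    (fun α => isClosed_closure.isCompact) (fun α => isClosed_closure) (by
      intro p hp
      have hpQ : p ∈ SFRegionallyProximal T X :=
        mem_iInter₂.2 fun α hα => mem_iInter.1 hp ⟨α, hα⟩
      have hcont : Continuous fun p : X × X => (π p.1, π p.2) := by fun_prop
      refine hcont.continuousAt.preimage_mem_nhds ?_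
      rw [← hQ p hpQ]
      exact nhds_le_uniformity _ hε)
  exact ⟨α, hα, fun t x x' h => hsub (subset_closure (show (x, x') ∈ _ from ⟨t, h⟩))⟩

/-- Regionally proximal pairs of a surjective semiflow are identified in every equicontinuous
factor. -/
theorem regionallyProximal_subset_of_isEqFactorRel {T : Type*} {X : Type u} [Monoid T]
    [TopologicalSpace T] [UniformSpace X] [CompactSpace X] [MulAction T X]
    (hsurj : ∀ t : T, Function.Surjective fun x : X => t • x)
    {S : Set (X × X)} (hS : SFIsEqFactorRel T X S) : SFRegionallyProximal T X ⊆ S := by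
  obtain ⟨Y, _, _, _, _, _, π, hπ, hπs, hmap, heq, rfl⟩ := hS
  have hsurjY : ∀ t : T, Function.Surjective fun y : Y => t • y := fun t y => by
    obtain ⟨x, rfl⟩ := hπs y
    obtain ⟨z, rfl⟩ := hsurj t x
    exact ⟨π z, (hmap t z).symm⟩
  rintro ⟨x, x'⟩ hp
  refine eq_of_uniformity fun {ε} hε => ?_
  obtain ⟨δ, ⟨hδ, hδc⟩, hδε⟩ := uniformity_hasBasis_closed.mem_iff.1 hε
  obtain ⟨η, hη, hηδ⟩ := heq.exists_forall_smul_mem hsurjY hδ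
  have huc := CompactSpace.uniformContinuous_of_continuous hπ
  have hcont : Continuous fun p : X × X => (π p.1, π p.2) := by fun_prop
  refine hδε (closure_minimal ?_ (hδc.preimage hcont) (mem_iInter₂.1 hp _ (huc hη)))
  rintro ⟨a, b⟩ ⟨t, ht⟩
  refine hηδ t (π a) (π b) ?_
  simpa [hmap] using ht

/-- A closed invariant equivalence relation containing the regionally proximal relation of a
surjective semiflow has an equicontinuous quotient. -/
theorem isEqFactorRel_of_regionallyProximal_subset {T : Type*} {X : Type u} [Monoid T]
    [TopologicalSpace T] [UniformSpace X] [CompactSpace X] [T2Space X]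
    [MulAction T X] [ContinuousSMul T X]
    (hsurj : ∀ t : T, Function.Surjective fun x : X => t • x)
    {R : Set (X × X)} (hRc : IsClosed R) (hRi : SFInvariantRel T R)
    (hRe : Equivalence fun a b : X => (a, b) ∈ R) (hQ : SFRegionallyProximal T X ⊆ R) :
    SFIsEqFactorRel T X R := by
  let r : Setoid X := ⟨fun a b => (a, b) ∈ R, hRe⟩
  have hcont : Continuous (Quotient.mk r) := continuous_quot_mk
  have hsurjπ : Function.Surjective (Quotient.mk r) := Quotient.mk_surjective
  have hT2 : T2Space (Quotient r) :=
    (isClosedMap_quotientMk_of_isClosed r hRc).t2Space_of_surjective hcont hsurjπ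
  let uY : UniformSpace (Quotient r) := uniformSpaceOfCompactR1
  let aY : MulAction T (Quotient r) :=
    { smul := fun t => Quotient.map (t • ·) fun a b h => hRi t (a, b) h
      one_smul := by
        rintro ⟨x⟩
        exact congrArg (Quotient.mk r) (one_smul T x)
      mul_smul := by
        rintro s t ⟨x⟩
        exact congrArg (Quotient.mk r) (mul_smul s t x) }
  have hmap : ∀ (t : T) (x : X), Quotient.mk r (t • x) = t • Quotient.mk r x := fun _ _ => rfl
  have hcs : ContinuousSMul T (Quotient r) := by
    refine ⟨?_⟩
    have hq : IsQuotientMap (Prod.map id (Quotient.mk r) : T × X → T × Quotient r) :=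
      (isProperMap_id.prodMap hcont.isProperMap).isClosedMap.isQuotientMap
        (continuous_id.prodMap hcont) (Function.surjective_id.prodMap hsurjπ)
    rw [hq.continuous_iff]
    exact hcont.comp continuous_smul
  have hker : ∀ a b : X, Quotient.mk r a = Quotient.mk r b ↔ (a, b) ∈ R := fun a b => Quotient.eq
  refine ⟨Quotient r, uY, inferInstance, hT2, aY, hcs, Quotient.mk r, hcont, hsurjπ, hmap, ?_, ?_⟩
  · have h := uniformEquicontinuous_comp_smul hsurj (π := Quotient.mk r) fun ε hε =>
      exists_forall_smul_mem_of_regionallyProximal (T := T) hcont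
        (fun p hp => (hker _ _).2 (hQ hp)) hε
    have h' : UniformEquicontinuous fun (t : T) (y : Quotient r) => t • y :=
      UniformEquicontinuous.of_comp_surjective hcont hsurjπ h
    exact fun ε hε => ⟨_, h' ε hε, fun p hp => hp⟩
  · ext ⟨a, b⟩
    exact (hker a b).symm

/-- For a surjective minimal semiflow `(T,X)`, the equicontinuous
structure relation `S_eq(X)` is the smallest closed `T`-invariant equivalence relation
containing the regionally proximal relation `Q(X)`. -/
theorem stmt10 (T : Type*) (X : Type u) [Monoid T] [TopologicalSpace T]
    [UniformSpace X] [CompactSpace X] [T2Space X]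
    [MulAction T X] [ContinuousSMul T X]
    (hmin : SFMinimal T X)
    (hsurj : ∀ t : T, Function.Surjective fun x : X => t • x)
    (S : Set (X × X)) (hS : SFIsEqStructureRel T X S) :
    SFRegionallyProximal T X ⊆ S ∧
    IsClosed S ∧ SFInvariantRel T S ∧
    Equivalence (fun a b : X => (a, b) ∈ S) ∧
    ∀ R : Set (X × X), IsClosed R → SFInvariantRel T R →
      Equivalence (fun a b : X => (a, b) ∈ R) →
      SFRegionallyProximal T X ⊆ R → S ⊆ R := by
  refine ⟨regionallyProximal_subset_of_isEqFactorRel hsurj hS.1, ?_, ?_, ?_,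
    fun R hRc hRi hRe hQ =>
      hS.2 R (isEqFactorRel_of_regionallyProximal_subset hsurj hRc hRi hRe hQ)⟩
  all_goals obtain ⟨Y, _, _, _, _, _, π, hπ, -, hmap, -, rfl⟩ := hS.1
  · exact isClosed_eq (hπ.comp continuous_fst) (hπ.comp continuous_snd)
  · intro t p hp
    change π (t • p.1) = π (t • p.2)
    rw [hmap, hmap, show π p.1 = π p.2 from hp]
  · exact ⟨fun _ => rfl, fun h => Eq.symm h, fun h h' => Eq.trans h h'⟩
end

section
/- Let (T,X) be a minimal semiflow, let (T,Y) be a semiflow admitting an invariant regular Borel probability measure μ, and let J be a closed T-invariant subset of X × Y (invariant under the diagonal action t·(x,y) = (tx,ty)). Then for all x, x′ ∈ X the sections have equal measure: μ(J_x) = μ(J_{x′}), where J_x = { y ∈ Y : (x,y) ∈ J }. -/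
open Filter Topology Set Function MeasureTheory
open scoped Uniformity symmDiff

universe u v

/-- For closed `J ⊆ X × Y` with `Y` compact and `μ` outer regular, the function `x ↦ μ J_x` is
upper semicontinuous. -/
theorem upperSemicontinuous_measure_section {X Y : Type*} [TopologicalSpace X]
    [TopologicalSpace Y] [CompactSpace Y] [MeasurableSpace Y] (μ : Measure Y) [μ.OuterRegular]
    {J : Set (X × Y)} (hJ : IsClosed J) :
    UpperSemicontinuous fun x => μ {y : Y | (x, y) ∈ J} := by
  intro x r hr
  obtain ⟨V, hxV, hV, hVr⟩ := Set.exists_isOpen_lt_of_lt _ r hr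
  have hclosed : IsClosed (Prod.fst '' (J ∩ Prod.snd ⁻¹' Vᶜ)) :=
    isClosedMap_fst_of_compactSpace _ (hJ.inter (hV.isClosed_compl.preimage continuous_snd))
  have hx : x ∈ (Prod.fst '' (J ∩ Prod.snd ⁻¹' Vᶜ))ᶜ := by
    rintro ⟨⟨_, y⟩, ⟨hyJ, hyV⟩, rfl⟩
    exact hyV (hxV hyJ)
  filter_upwards [hclosed.isOpen_compl.mem_nhds hx] with z hz
  refine (measure_mono fun y hy => ?_).trans_lt hVr
  by_contra hyV
  exact hz ⟨(z, y), ⟨hy, hyV⟩, rfl⟩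

/-- Sections of a closed invariant set do not lose measure along orbits. -/
theorem measure_section_le_smul {T X Y : Type*} [SMul T X] [SMul T Y]
    [TopologicalSpace X] [TopologicalSpace Y] [MeasurableSpace Y] [BorelSpace Y]
    {μ : Measure Y} (hμ : SFInvariantMeasure T μ) {J : Set (X × Y)} (hJ : IsClosed J)
    (hJinv : ∀ (t : T), ∀ p ∈ J, (t • p.1, t • p.2) ∈ J) (t : T) (x : X) :
    μ {y : Y | (x, y) ∈ J} ≤ μ {y : Y | (t • x, y) ∈ J} := by
  have hmeas : MeasurableSet {y : Y | (t • x, y) ∈ J} :=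
    (hJ.preimage (Continuous.prodMk_right (t • x))).measurableSet
  rw [← hμ.2 t _ hmeas]
  exact measure_mono fun y hy => hJinv t (x, y) hy

/-- Let `(T,X)` be minimal, `(T,Y)` a semiflow with invariant regular
Borel probability measure `μ`, and `J ⊆ X × Y` closed and invariant. Then all sections
of `J` have equal measure: `μ(J_x) = μ(J_{x'})`. -/
theorem stmt12 (T : Type*) (X : Type u) (Y : Type v) [Monoid T] [TopologicalSpace T]
    [TopologicalSpace X] [CompactSpace X] [T2Space X]
    [MulAction T X] [ContinuousSMul T X]
    [TopologicalSpace Y] [CompactSpace Y] [T2Space Y]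
    [MulAction T Y] [ContinuousSMul T Y]
    [MeasurableSpace Y] [BorelSpace Y]
    (hmin : SFMinimal T X)
    (μ : Measure Y) (hμ : SFInvariantMeasure T μ) (hreg : μ.Regular)
    (J : Set (X × Y)) (hJclosed : IsClosed J)
    (hJinv : ∀ (t : T), ∀ p ∈ J, (t • p.1, t • p.2) ∈ J) :
    ∀ x x' : X, μ {y : Y | (x, y) ∈ J} = μ {y : Y | (x', y) ∈ J} := by
  have hle : ∀ x x' : X, μ {y : Y | (x, y) ∈ J} ≤ μ {y : Y | (x', y) ∈ J} := by
    intro x x'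
    by_contra! hlt
    have hU := (upperSemicontinuous_measure_section μ hJclosed).isOpen_preimage
      (μ {y : Y | (x, y) ∈ J})
    obtain ⟨_, hz, t, rfl⟩ := (hmin x).inter_open_nonempty _ hU ⟨x', hlt⟩
    exact (measure_section_le_smul hμ hJclosed hJinv t x).not_gt hz
  exact fun x x' => (hle x x').antisymm (hle x' x)
end
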